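/- arXiv:2506.20086 — 2 statements merged into one kernel-verified Lean document; each statement's English description precedes it below -/
import Mathlib

section
/- For every integer n ≥ 11, the graph G_n^• does not contain the complete bipartite graph K_{2,6} as a minor. -/
/-- Labels in `Fin 10`: `0 = h¹`, `1 = h²`, `2 = h₁`, `3 = h₂`, `4 = h₃`,
`5 = h₁¹`, `6 = h₂¹`, `7 = h₃¹`, `8 = h₁²`, `9 = h₂²`.  The edges among these
vertices, including the five dashed edges `h₁h₂, h₂h₃, h₃h₁, h₁h², h₃h²`. -/
def bulletBase : List (Fin 10 × Fin 10) :=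
  [(0,5),(0,6),(0,7),(1,8),(1,9),
   (2,5),(2,8),(2,7),
   (3,5),(3,8),(3,6),(3,9),
   (4,6),(4,9),(4,7),
   (2,3),(3,4),(4,2),(2,1),(4,1)]

/-- The graph `G_n^•` for `n ≥ 11`.  The vertex `Sum.inr k` is `v_{k+1}`,
for `0 ≤ k ≤ n - 11`, so that `v₁ = Sum.inr 0` and `v_{n-10} = Sum.inr (n-11)`. -/
def GBullet (n : ℕ) : SimpleGraph (Fin 10 ⊕ Fin (n - 10)) :=
  SimpleGraph.fromRel (fun a b =>
    match a, b with
    | Sum.inl i, Sum.inl j => (i, j) ∈ bulletBase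
    | Sum.inl i, Sum.inr k =>
        (i = 2 ∧ (k : ℕ) = 0) ∨ (i = 4 ∧ (k : ℕ) = n - 11) ∨ i = 1
    | Sum.inr _, Sum.inl _ => False
    | Sum.inr k, Sum.inr l => (l : ℕ) = (k : ℕ) + 1)

/-- `G` contains `K` as a minor: there are pairwise disjoint nonempty branch sets
`B w ⊆ V(G)`, each inducing a connected subgraph of `G`, such that every edge of `K`
is witnessed by an edge of `G` between the corresponding branch sets. -/
def HasMinor {V W : Type*} (G : SimpleGraph V) (K : SimpleGraph W) : Prop :=
  ∃ B : W → Set V,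
    (∀ w, (B w).Nonempty) ∧
    (∀ w₁ w₂, w₁ ≠ w₂ → Disjoint (B w₁) (B w₂)) ∧
    (∀ w, (G.induce (B w)).Connected) ∧
    (∀ w₁ w₂, K.Adj w₁ w₂ → ∃ u ∈ B w₁, ∃ v ∈ B w₂, G.Adj u v)

/-! ### Connected sets described by boundary edges -/

section Connectivity

variable {V V' W : Type*} {G : SimpleGraph V} {G' : SimpleGraph V'} {K : SimpleGraph W}

/-- `S` is nonempty, and every splitting of `S` into two nonempty parts is crossed by an edge. -/
def IsConnectedSet (G : SimpleGraph V) (S : Set V) : Prop :=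
  S.Nonempty ∧ ∀ T : Set V, (∃ x ∈ S, x ∈ T) → (∃ x ∈ S, x ∉ T) →
    ∃ u ∈ S, u ∈ T ∧ ∃ v ∈ S, v ∉ T ∧ G.Adj u v

theorem isConnectedSet_iff {S : Set V} : IsConnectedSet G S ↔ (G.induce S).Connected := by
  constructor
  · rintro ⟨⟨x, hx⟩, h⟩
    have : Nonempty S := ⟨⟨x, hx⟩⟩
    refine SimpleGraph.Connected.mk fun a b => ?_
    by_contra hab
    obtain ⟨u, hu, ⟨hu', hau⟩, v, hv, hvT, huv⟩ :=
      h {y | ∃ hy : y ∈ S, (G.induce S).Reachable a ⟨y, hy⟩}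
        ⟨a, a.2, a.2, SimpleGraph.Reachable.refl _⟩ ⟨b, b.2, fun ⟨_, hb⟩ => hab hb⟩
    refine hvT ⟨hv, hau.trans (SimpleGraph.Adj.reachable ?_)⟩
    simpa using huv
  · intro h
    obtain ⟨⟨x, hx⟩⟩ := h.nonempty
    refine ⟨⟨x, hx⟩, ?_⟩
    rintro T ⟨a, ha, haT⟩ ⟨b, hb, hbT⟩
    obtain ⟨p⟩ := h.preconnected ⟨a, ha⟩ ⟨b, hb⟩
    obtain ⟨d, -, hd, hd'⟩ := p.exists_boundary_dart {y | (y : V) ∈ T} haT hbT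
    exact ⟨d.fst, d.fst.2, hd, d.snd, d.snd.2, hd', by simpa using d.adj⟩

theorem IsConnectedSet.image {S : Set V} (hS : IsConnectedSet G S) {φ : V → V'}
    (hφ : ∀ u v, G.Adj u v → φ u = φ v ∨ G'.Adj (φ u) (φ v)) : IsConnectedSet G' (φ '' S) := by
  refine ⟨hS.1.image φ, ?_⟩
  rintro T ⟨_, ⟨a, ha, rfl⟩, haT⟩ ⟨_, ⟨b, hb, rfl⟩, hbT⟩
  obtain ⟨u, hu, huT, v, hv, hvT, huv⟩ := hS.2 (φ ⁻¹' T) ⟨a, ha, haT⟩ ⟨b, hb, hbT⟩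
  refine ⟨φ u, ⟨u, hu, rfl⟩, huT, φ v, ⟨v, hv, rfl⟩, hvT, (hφ u v huv).resolve_left ?_⟩
  intro h
  exact hvT (h ▸ huT : φ v ∈ T)

/-- A vertex dominated by another vertex `z` of a connected set can be removed from it. -/
theorem IsConnectedSet.diff_singleton {S : Set V} (hS : IsConnectedSet G S) {x z : V}
    (hz : z ∈ S) (hzx : z ≠ x) (hx : ∀ y, G.Adj x y → y = z ∨ G.Adj z y) :
    IsConnectedSet G (S \ {x}) := by
  refine ⟨⟨z, hz, hzx⟩, ?_⟩
  rintro T ⟨a, ⟨ha, hax⟩, haT⟩ ⟨b, ⟨hb, hbx⟩, hbT⟩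
  by_cases hzT : z ∈ T
  · obtain ⟨u, hu, huT, v, hv, hvT, huv⟩ := hS.2 (T ∪ {x}) ⟨a, ha, Or.inl haT⟩
      ⟨b, hb, fun h => h.elim hbT hbx⟩
    have hvx : v ≠ x := fun h => hvT (Or.inr h)
    have hvT' : v ∉ T := fun h => hvT (Or.inl h)
    by_cases hux : u = x
    · subst hux
      rcases hx v huv with rfl | h
      · exact absurd hzT hvT'
      · exact ⟨z, ⟨hz, hzx⟩, hzT, v, ⟨hv, hvx⟩, hvT', h⟩
    · exact ⟨u, ⟨hu, hux⟩, huT.resolve_right hux, v, ⟨hv, hvx⟩, hvT', huv⟩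
  · obtain ⟨u, hu, ⟨huT, hux⟩, v, hv, hvT, huv⟩ := hS.2 (T \ {x}) ⟨a, ha, haT, hax⟩
      ⟨b, hb, fun h => hbT h.1⟩
    by_cases hvx : v = x
    · subst hvx
      rcases hx u huv.symm with rfl | h
      · exact absurd huT hzT
      · exact ⟨u, ⟨hu, hux⟩, huT, z, ⟨hz, hzx⟩, hzT, h.symm⟩
    · exact ⟨u, ⟨hu, hux⟩, huT, v, ⟨hv, hvx⟩, fun h => hvT ⟨h, hvx⟩, huv⟩

/-! ### Minor models -/

/-- The sets `B w` are the branch sets of a `K`-minor of `G`. -/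
structure IsMinorModel (G : SimpleGraph V) (K : SimpleGraph W) (B : W → Set V) : Prop where
  eq_of_mem : ∀ {w₁ w₂ x}, x ∈ B w₁ → x ∈ B w₂ → w₁ = w₂
  connected : ∀ w, IsConnectedSet G (B w)
  adj : ∀ {w₁ w₂}, K.Adj w₁ w₂ → ∃ u ∈ B w₁, ∃ v ∈ B w₂, G.Adj u v

theorem hasMinor_iff : HasMinor G K ↔ ∃ B, IsMinorModel G K B := by
  constructor
  · rintro ⟨B, -, hd, hc, ha⟩
    refine ⟨B, ?_, fun w => isConnectedSet_iff.2 (hc w), fun h => ha _ _ h⟩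
    intro w₁ w₂ x h₁ h₂
    by_contra hne
    exact Set.disjoint_left.1 (hd _ _ hne) h₁ h₂
  · rintro ⟨B, hd, hc, ha⟩
    exact ⟨B, fun w => (hc w).1,
      fun w₁ w₂ hne => Set.disjoint_left.2 fun x h₁ h₂ => hne (hd h₁ h₂),
      fun w => isConnectedSet_iff.1 (hc w), fun _ _ h => ha h⟩

/-- The image of a minor model under a contraction that identifies no two vertices of distinct
branch sets. -/
theorem IsMinorModel.hasMinor_of_map {B : W → Set V} (hB : IsMinorModel G K B) {φ : V → V'}
    (hφ : ∀ u v, G.Adj u v → φ u = φ v ∨ G'.Adj (φ u) (φ v))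
    (hsep : ∀ w₁ w₂ u v, u ∈ B w₁ → v ∈ B w₂ → φ u = φ v → w₁ = w₂) : HasMinor G' K := by
  refine hasMinor_iff.2 ⟨fun w => φ '' B w, ?_, fun w => (hB.connected w).image hφ, ?_⟩
  · rintro w₁ w₂ _ ⟨u, hu, rfl⟩ ⟨v, hv, h⟩
    exact hsep _ _ _ _ hu hv h.symm
  · intro w₁ w₂ h
    obtain ⟨u, hu, v, hv, huv⟩ := hB.adj h
    exact ⟨φ u, ⟨u, hu, rfl⟩, φ v, ⟨v, hv, rfl⟩,
      (hφ u v huv).resolve_left fun he => h.ne (hsep _ _ _ _ hu hv he)⟩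

/-- A vertex dominated by another vertex of its branch set can be deleted. -/
theorem IsMinorModel.diff_singleton {B : W → Set V} (hB : IsMinorModel G K B) {x z : V} {w : W}
    (hxw : x ∈ B w) (hzw : z ∈ B w) (hzx : z ≠ x) (hx : ∀ y, G.Adj x y → y = z ∨ G.Adj z y) :
    IsMinorModel G K fun w => B w \ {x} := by
  refine ⟨fun h₁ h₂ => hB.eq_of_mem h₁.1 h₂.1, ?_, ?_⟩
  · intro w'
    by_cases hw : w' = w
    · subst hw
      exact (hB.connected w').diff_singleton hzw hzx hx
    · have : x ∉ B w' := fun h => hw (hB.eq_of_mem h hxw)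
      simpa [Set.sdiff_singleton_eq_self this] using hB.connected w'
  · intro w₁ w₂ h
    obtain ⟨u, hu, v, hv, huv⟩ := hB.adj h
    by_cases hux : u = x
    · subst hux
      obtain rfl := hB.eq_of_mem hu hxw
      have hvz : v ≠ z := fun e => h.ne (hB.eq_of_mem hzw (e ▸ hv))
      exact ⟨z, ⟨hzw, hzx⟩, v, ⟨hv, huv.ne'⟩, (hx v huv).resolve_left hvz⟩
    by_cases hvx : v = x
    · subst hvx
      obtain rfl := hB.eq_of_mem hv hxw
      have huz : u ≠ z := fun e => h.ne (hB.eq_of_mem (e ▸ hu) hzw)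
      exact ⟨u, ⟨hu, huv.ne⟩, z, ⟨hzw, hzx⟩, ((hx u huv.symm).resolve_left huz).symm⟩
    exact ⟨u, ⟨hu, hux⟩, v, ⟨hv, hvx⟩, huv⟩

end Connectivity

/-! ### Shortening the path -/

section Path

theorem gBullet_adj_inl_inl {n : ℕ} {i j : Fin 10} :
    (GBullet n).Adj (Sum.inl i) (Sum.inl j) ↔
      i ≠ j ∧ ((i, j) ∈ bulletBase ∨ (j, i) ∈ bulletBase) := by
  simp [GBullet]

theorem gBullet_adj_inl_inr {n : ℕ} {i : Fin 10} {k : Fin (n - 10)} :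
    (GBullet n).Adj (Sum.inl i) (Sum.inr k) ↔
      (i = 2 ∧ (k : ℕ) = 0) ∨ (i = 4 ∧ (k : ℕ) = n - 11) ∨ i = 1 := by
  simp [GBullet]

theorem gBullet_adj_inr_inl {n : ℕ} {i : Fin 10} {k : Fin (n - 10)} :
    (GBullet n).Adj (Sum.inr k) (Sum.inl i) ↔
      (i = 2 ∧ (k : ℕ) = 0) ∨ (i = 4 ∧ (k : ℕ) = n - 11) ∨ i = 1 := by
  rw [SimpleGraph.adj_comm, gBullet_adj_inl_inr]

theorem gBullet_adj_inr_inr {n : ℕ} {k l : Fin (n - 10)} :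
    (GBullet n).Adj (Sum.inr k) (Sum.inr l) ↔ (l : ℕ) = k + 1 ∨ (k : ℕ) = l + 1 := by
  simp only [GBullet, SimpleGraph.fromRel_adj, ne_eq, Sum.inr.injEq, Fin.ext_iff]
  omega

instance (n : ℕ) : DecidableRel (GBullet n).Adj
  | Sum.inl _, Sum.inl _ => decidable_of_iff' _ gBullet_adj_inl_inl
  | Sum.inl _, Sum.inr _ => decidable_of_iff' _ gBullet_adj_inl_inr
  | Sum.inr _, Sum.inl _ => decidable_of_iff' _ gBullet_adj_inr_inl
  | Sum.inr _, Sum.inr _ => decidable_of_iff' _ gBullet_adj_inr_inr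

/-- The vertices of the path `h₁, v₁, …, v_{n-10}, h₃`, numbered from `0` to `n - 9`. -/
def pathVertex (n t : ℕ) : Fin 10 ⊕ Fin (n - 10) :=
  if t = 0 then Sum.inl 2 else if h : t - 1 < n - 10 then Sum.inr ⟨t - 1, h⟩ else Sum.inl 4

/-- The contraction of the `k`-th edge of the path `h₁, v₁, …, v_{n-9}, h₃`. -/
def contractPath (n k : ℕ) : Fin 10 ⊕ Fin (n + 1 - 10) → Fin 10 ⊕ Fin (n - 10)
  | Sum.inl i => Sum.inl i
  | Sum.inr j => pathVertex n (if (j : ℕ) + 1 ≤ k then j + 1 else j)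

theorem pathVertex_zero {n : ℕ} : pathVertex n 0 = Sum.inl 2 := rfl

theorem pathVertex_last {n t : ℕ} (hn : 10 ≤ n) (ht : t + 9 = n) :
    pathVertex n t = Sum.inl 4 := by
  rw [pathVertex, if_neg (by omega), dif_neg (by omega)]

theorem pathVertex_inner {n t : ℕ} (ht : 1 ≤ t) (htn : t + 10 ≤ n) :
    pathVertex n t = Sum.inr ⟨t - 1, by omega⟩ := by
  rw [pathVertex, if_neg (by omega), dif_pos]

theorem inr_eq_pathVertex {n : ℕ} (j : Fin (n - 10)) :
    Sum.inr j = pathVertex n (j + 1) := by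
  rw [pathVertex_inner (by omega) (by omega)]
  rfl

theorem eq_of_pathVertex_eq_inl {n t : ℕ} (hn : 10 ≤ n) (ht : t + 9 ≤ n) {i : Fin 10}
    (h : pathVertex n t = Sum.inl i) : t = 0 ∧ i = 2 ∨ t + 9 = n ∧ i = 4 := by
  unfold pathVertex at h
  split_ifs at h
  · exact Or.inl ⟨‹_›, (Sum.inl.inj h).symm⟩
  · exact Or.inr ⟨by omega, (Sum.inl.inj h).symm⟩

theorem pathVertex_injOn {n s t : ℕ} (hn : 10 ≤ n) (hs : s + 9 ≤ n) (ht : t + 9 ≤ n)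
    (h : pathVertex n s = pathVertex n t) : s = t := by
  unfold pathVertex at h
  split_ifs at h <;> simp at h <;> omega

theorem adj_pathVertex_succ {n t : ℕ} (hn : 11 ≤ n) (ht : t + 10 ≤ n) :
    (GBullet n).Adj (pathVertex n t) (pathVertex n (t + 1)) := by
  rcases Nat.eq_zero_or_pos t with rfl | ht0
  · rw [pathVertex_zero, pathVertex_inner (by omega) (by omega), gBullet_adj_inl_inr]
    simp
  rw [pathVertex_inner ht0 ht]
  rcases Nat.lt_or_ge (t + 10) n with h | h
  · rw [pathVertex_inner (by omega) (by omega), gBullet_adj_inr_inr]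
    simp only
    omega
  · rw [pathVertex_last (by omega) (by omega), gBullet_adj_inr_inl]
    exact Or.inr (Or.inl ⟨rfl, by simp only; omega⟩)

theorem adj_inl_one_pathVertex {n t : ℕ} :
    (GBullet n).Adj (Sum.inl 1) (pathVertex n t) := by
  unfold pathVertex
  split_ifs
  · exact gBullet_adj_inl_inl.2 (by decide)
  · exact gBullet_adj_inl_inr.2 (by simp)
  · exact gBullet_adj_inl_inl.2 (by decide)

theorem eq_of_adj_pathVertex {n t : ℕ} (ht : 1 ≤ t) (htn : t + 10 ≤ n) {y : Fin 10 ⊕ Fin (n - 10)}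
    (h : (GBullet n).Adj (pathVertex n t) y) :
    y = pathVertex n (t - 1) ∨ y = pathVertex n (t + 1) ∨ y = Sum.inl 1 := by
  rw [pathVertex_inner ht htn] at h
  rcases y with i | j
  · rw [gBullet_adj_inr_inl] at h
    rcases h with ⟨rfl, h⟩ | ⟨rfl, h⟩ | rfl
    · simp only at h
      rw [h]
      exact Or.inl rfl
    · simp only at h
      exact Or.inr (Or.inl (pathVertex_last (by omega) (by omega)).symm)
    · exact Or.inr (Or.inr rfl)
  · rw [gBullet_adj_inr_inr] at h
    simp only at h
    rw [inr_eq_pathVertex]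
    rcases h with h | h
    · exact Or.inr (Or.inl (by rw [h]; congr 1; omega))
    · exact Or.inl (by rw [h])

theorem adj_inl_one_of_adj_pathVertex {n t : ℕ} (ht : 1 ≤ t) (htn : t + 10 ≤ n)
    {y : Fin 10 ⊕ Fin (n - 10)} (h : (GBullet n).Adj (pathVertex n t) y) :
    y = Sum.inl 1 ∨ (GBullet n).Adj (Sum.inl 1) y := by
  rcases eq_of_adj_pathVertex ht htn h with rfl | rfl | rfl
  · exact Or.inr adj_inl_one_pathVertex
  · exact Or.inr adj_inl_one_pathVertex
  · exact Or.inl rfl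

theorem contractPath_pathVertex {n k t : ℕ} (hn : 10 ≤ n) (hk : k + 9 ≤ n) (ht : t + 8 ≤ n) :
    contractPath n k (pathVertex (n + 1) t) = pathVertex n (if t ≤ k then t else t - 1) := by
  rcases Nat.eq_zero_or_pos t with rfl | ht0
  · simp [pathVertex_zero, contractPath]
  rcases Nat.lt_or_ge (t + 8) n with h | h
  · rw [pathVertex_inner ht0 (by omega), contractPath]
    simp only [Nat.sub_add_cancel ht0]
  · rw [pathVertex_last (n := n + 1) (by omega) (by omega), if_neg (by omega),
      pathVertex_last hn (by omega), contractPath]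

theorem contractPath_adj_pathVertex {n k t : ℕ} (hn : 11 ≤ n) (hk : k + 9 ≤ n) (ht : 1 ≤ t)
    (htn : t + 9 ≤ n) {y : Fin 10 ⊕ Fin (n + 1 - 10)}
    (h : (GBullet (n + 1)).Adj (pathVertex (n + 1) t) y) :
    contractPath n k (pathVertex (n + 1) t) = contractPath n k y ∨
      (GBullet n).Adj (contractPath n k (pathVertex (n + 1) t)) (contractPath n k y) := by
  rcases eq_of_adj_pathVertex ht (by omega) h with rfl | rfl | rfl
  · rw [contractPath_pathVertex (by omega) hk (by omega),
      contractPath_pathVertex (by omega) hk (by omega)]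
    have key := fun s => adj_pathVertex_succ (n := n) (t := s) hn
    rcases lt_trichotomy t (k + 1) with h | h | h
    · rw [if_pos (by omega), if_pos (by omega)]
      have := key (t - 1) (by omega)
      rw [Nat.sub_add_cancel ht] at this
      exact Or.inr this.symm
    · rw [if_neg (by omega), if_pos (by omega)]
      exact Or.inl rfl
    · rw [if_neg (by omega), if_neg (by omega)]
      have := key (t - 1 - 1) (by omega)
      rw [Nat.sub_add_cancel (by omega)] at this
      exact Or.inr this.symm
  · rw [contractPath_pathVertex (by omega) hk (by omega),
      contractPath_pathVertex (by omega) hk (by omega)]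
    have key := fun s => adj_pathVertex_succ (n := n) (t := s) hn
    rcases lt_trichotomy t k with h | h | h
    · rw [if_pos (by omega), if_pos (by omega)]
      exact Or.inr (key t (by omega))
    · rw [if_pos (by omega), if_neg (by omega)]
      exact Or.inl rfl
    · rw [if_neg (by omega), if_neg (by omega)]
      have := key (t - 1) (by omega)
      rw [Nat.sub_add_cancel ht] at this
      exact Or.inr this
  · rw [contractPath_pathVertex (by omega) hk (by omega)]
    exact Or.inr adj_inl_one_pathVertex.symm

theorem contractPath_adj {n k : ℕ} (hn : 11 ≤ n) (hk : k + 9 ≤ n) (u v : Fin 10 ⊕ Fin (n + 1 - 10))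
    (h : (GBullet (n + 1)).Adj u v) :
    contractPath n k u = contractPath n k v ∨
      (GBullet n).Adj (contractPath n k u) (contractPath n k v) := by
  rcases u with i | j
  · rcases v with i' | j'
    · exact Or.inr (gBullet_adj_inl_inl.2 (gBullet_adj_inl_inl.1 h))
    · rw [inr_eq_pathVertex] at h ⊢
      exact (contractPath_adj_pathVertex hn hk (by omega) (by omega) h.symm).imp
        Eq.symm SimpleGraph.Adj.symm
  · rw [inr_eq_pathVertex] at h ⊢
    exact contractPath_adj_pathVertex hn hk (by omega) (by omega) h

theorem eq_or_of_contractPath_pathVertex_eq {n k t : ℕ} (hn : 11 ≤ n) (hk : k + 9 ≤ n)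
    (htn : t + 9 ≤ n) {v : Fin 10 ⊕ Fin (n + 1 - 10)}
    (h : contractPath n k (pathVertex (n + 1) t) = contractPath n k v) :
    pathVertex (n + 1) t = v ∨
      (t = k ∧ v = pathVertex (n + 1) (k + 1)) ∨ (v = pathVertex (n + 1) k ∧ t = k + 1) := by
  have hv : ∃ s, s + 8 ≤ n ∧ v = pathVertex (n + 1) s := by
    rcases v with i | j
    · rw [contractPath_pathVertex (by omega) hk (by omega)] at h
      rcases eq_of_pathVertex_eq_inl (by omega) (by split_ifs <;> omega) h with
        ⟨-, rfl⟩ | ⟨-, rfl⟩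
      · exact ⟨0, by omega, rfl⟩
      · exact ⟨n - 8, by omega, (pathVertex_last (by omega) (by omega)).symm⟩
    · exact ⟨j + 1, by omega, inr_eq_pathVertex j⟩
  obtain ⟨s, hs, rfl⟩ := hv
  rw [contractPath_pathVertex (by omega) hk (by omega),
    contractPath_pathVertex (by omega) hk (by omega)] at h
  have := pathVertex_injOn (by omega) (by split_ifs <;> omega) (by split_ifs <;> omega) h
  have : t = s ∨ (t = k ∧ s = k + 1) ∨ (s = k ∧ t = k + 1) := by
    split_ifs at this <;> omega
  rcases this with rfl | ⟨rfl, rfl⟩ | ⟨rfl, rfl⟩ <;> simp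

theorem eq_or_of_contractPath_eq {n k : ℕ} (hn : 11 ≤ n) (hk : k + 9 ≤ n)
    {u v : Fin 10 ⊕ Fin (n + 1 - 10)} (h : contractPath n k u = contractPath n k v) :
    u = v ∨ (u = pathVertex (n + 1) k ∧ v = pathVertex (n + 1) (k + 1)) ∨
      (v = pathVertex (n + 1) k ∧ u = pathVertex (n + 1) (k + 1)) := by
  rcases u with i | j
  · rcases v with i' | j'
    · exact Or.inl (by simpa [contractPath] using h)
    · rw [inr_eq_pathVertex] at h ⊢
      rcases eq_or_of_contractPath_pathVertex_eq hn hk (by omega) h.symm with h | ⟨h, h'⟩ | ⟨h, h'⟩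
      · exact Or.inl h.symm
      · exact Or.inr (Or.inr ⟨by rw [h], h'⟩)
      · exact Or.inr (Or.inl ⟨h, by rw [h']⟩)
  · rw [inr_eq_pathVertex] at h ⊢
    rcases eq_or_of_contractPath_pathVertex_eq hn hk (by omega) h with h | ⟨h, h'⟩ | ⟨h, h'⟩
    · exact Or.inl h
    · exact Or.inr (Or.inl ⟨by rw [h], h'⟩)
    · exact Or.inr (Or.inr ⟨h, by rw [h']⟩)

variable {W : Type*} {K : SimpleGraph W} {n : ℕ} {B : W → Set (Fin 10 ⊕ Fin (n + 1 - 10))}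

/-- If `K` is not a minor of the next smaller graph, then consecutive path vertices lie in
distinct branch sets. -/
theorem exists_ne_mem_pathVertex (hn : 11 ≤ n) (hK : ¬ HasMinor (GBullet n) K)
    (hB : IsMinorModel (GBullet (n + 1)) K B) {k : ℕ} (hk : k + 9 ≤ n) :
    ∃ w₁ w₂, w₁ ≠ w₂ ∧ pathVertex (n + 1) k ∈ B w₁ ∧ pathVertex (n + 1) (k + 1) ∈ B w₂ := by
  by_contra hne
  refine hK (hB.hasMinor_of_map (contractPath_adj hn hk) ?_)
  intro w₁ w₂ u v hu hv huv
  by_contra hw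
  rcases eq_or_of_contractPath_eq hn hk huv with rfl | ⟨rfl, rfl⟩ | ⟨rfl, rfl⟩
  · exact hw (hB.eq_of_mem hu hv)
  · exact hne ⟨w₁, w₂, hw, hu, hv⟩
  · exact hne ⟨w₂, w₁, Ne.symm hw, hv, hu⟩

theorem inl_one_notMem_of_pathVertex_mem (hn : 11 ≤ n) (hK : ¬ HasMinor (GBullet n) K)
    (hB : IsMinorModel (GBullet (n + 1)) K B) {t : ℕ} (ht : 1 ≤ t) (htn : t + 9 ≤ n) {w : W}
    (hw : pathVertex (n + 1) t ∈ B w) : Sum.inl 1 ∉ B w := by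
  intro h
  have hB' := hB.diff_singleton hw h adj_inl_one_pathVertex.ne
    fun y => adj_inl_one_of_adj_pathVertex ht (by omega)
  obtain ⟨_, _, -, h', -⟩ := exists_ne_mem_pathVertex hn hK hB' htn
  exact h'.2 rfl

theorem branchSet_eq_singleton (hn : 11 ≤ n) (hK : ¬ HasMinor (GBullet n) K)
    (hB : IsMinorModel (GBullet (n + 1)) K B) {t : ℕ} (ht : 1 ≤ t) (htn : t + 9 ≤ n) {w : W}
    (hw : pathVertex (n + 1) t ∈ B w) : B w = {pathVertex (n + 1) t} := by
  refine Set.eq_singleton_iff_unique_mem.2 ⟨hw, fun x hx => ?_⟩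
  by_contra hxt
  obtain ⟨u, -, rfl, v, hv, -, huv⟩ :=
    (hB.connected w).2 {pathVertex (n + 1) t} ⟨_, hw, rfl⟩ ⟨x, hx, hxt⟩
  rcases eq_of_adj_pathVertex ht (by omega) huv with rfl | rfl | rfl
  · obtain ⟨w₁, w₂, hne, h₁, h₂⟩ := exists_ne_mem_pathVertex hn hK hB (k := t - 1) (by omega)
    rw [Nat.sub_add_cancel ht] at h₂
    exact hne ((hB.eq_of_mem h₁ hv).trans (hB.eq_of_mem hw h₂))
  · obtain ⟨w₁, w₂, hne, h₁, h₂⟩ := exists_ne_mem_pathVertex hn hK hB htn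
    exact hne ((hB.eq_of_mem h₁ hw).trans (hB.eq_of_mem hv h₂))
  · exact inl_one_notMem_of_pathVertex_mem hn hK hB ht htn hw hv

end Path

theorem exists_mem_inr_of_pathVertex {n : ℕ}
    {B : Fin 2 ⊕ Fin 6 → Set (Fin 10 ⊕ Fin (n + 1 - 10))} (hn : 11 ≤ n)
    (hK : ¬ HasMinor (GBullet n) (completeBipartiteGraph (Fin 2) (Fin 6)))
    (hB : IsMinorModel (GBullet (n + 1)) (completeBipartiteGraph (Fin 2) (Fin 6)) B) {t : ℕ}
    (ht : 1 ≤ t) (htn : t + 9 ≤ n) : ∃ i, B (Sum.inr i) = {pathVertex (n + 1) t} := by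
  obtain ⟨w, _, -, hw, -⟩ := exists_ne_mem_pathVertex hn hK hB htn
  have hs := branchSet_eq_singleton hn hK hB ht htn hw
  rcases w with a | i
  swap
  · exact ⟨i, hs⟩
  have key : ∀ i : Fin 6, ∃ y ∈ B (Sum.inr i),
      (GBullet (n + 1)).Adj (pathVertex (n + 1) t) y := by
    intro i
    obtain ⟨u, hu, v, hv, huv⟩ := hB.adj (w₁ := Sum.inl a) (w₂ := Sum.inr i) (by simp)
    rw [hs] at hu
    exact ⟨v, hv, hu ▸ huv⟩
  choose y hy hadj using key
  have hinj : Function.Injective y := fun i j h =>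
    Sum.inr.inj (hB.eq_of_mem (hy i) (h ▸ hy j))
  have hsub : Finset.univ.image y ⊆
      {pathVertex (n + 1) (t - 1), pathVertex (n + 1) (t + 1), Sum.inl 1} := by
    intro z hz
    obtain ⟨i, -, rfl⟩ := Finset.mem_image.1 hz
    simpa using eq_of_adj_pathVertex ht (by omega) (hadj i)
  have hcard := (Finset.card_le_card hsub).trans Finset.card_le_three
  rw [Finset.card_image_of_injective _ hinj] at hcard
  simp at hcard

theorem not_hasMinor_gBullet_succ {n : ℕ} (hn : 12 ≤ n)
    (hK : ¬ HasMinor (GBullet n) (completeBipartiteGraph (Fin 2) (Fin 6))) :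
    ¬ HasMinor (GBullet (n + 1)) (completeBipartiteGraph (Fin 2) (Fin 6)) := by
  intro h
  obtain ⟨B, hB⟩ := hasMinor_iff.1 h
  obtain ⟨i₁, h₁⟩ := exists_mem_inr_of_pathVertex (t := 1) (by omega) hK hB le_rfl (by omega)
  obtain ⟨i₂, h₂⟩ := exists_mem_inr_of_pathVertex (t := 2) (by omega) hK hB (by omega) (by omega)
  obtain ⟨i₃, h₃⟩ := exists_mem_inr_of_pathVertex (t := 3) (by omega) hK hB (by omega) (by omega)
  have key : ∀ a, Sum.inl 1 ∈ B (Sum.inl a) := by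
    intro a
    obtain ⟨u, hu, v, hv, huv⟩ := hB.adj (w₁ := Sum.inr i₂) (w₂ := Sum.inl a) (by simp)
    rw [h₂] at hu
    obtain rfl := hu
    rcases eq_of_adj_pathVertex (by omega) (by omega) huv with rfl | rfl | rfl
    · have h : pathVertex (n + 1) 1 ∈ B (Sum.inr i₁) := by rw [h₁]; rfl
      exact absurd (hB.eq_of_mem hv h) (by simp)
    · have h : pathVertex (n + 1) 3 ∈ B (Sum.inr i₃) := by rw [h₃]; rfl
      exact absurd (hB.eq_of_mem hv h) (by simp)
    · exact hv
  exact absurd (hB.eq_of_mem (key 0) (key 1)) (by simp)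

/-! ### A kernel-friendly search for `K_{2,6}`-minors

A set of vertices is a bit mask, and a graph is a list of pairs consisting of a vertex and the mask
of its neighbours.  The functions use the binary operations of `Nat` directly so that the kernel
evaluates them quickly. -/

namespace MinorSearch

/-- `f n`, with `n` evaluated to a numeral first. -/
def force {α : Type} (n : ℕ) (f : ℕ → α) : α :=
  Nat.rec (f 0) (fun k _ => f (Nat.succ k)) n

theorem force_eq {α : Type} (n : ℕ) (f : ℕ → α) : force n f = f n := by
  cases n <;> rfl

/-- The `i`-th bit of `s`. -/
def bit (s i : ℕ) : Bool := Nat.beq (Nat.land (Nat.shiftRight s i) 1) 1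

theorem bit_eq (s i : ℕ) : bit s i = s.testBit i := by
  have h : bit s i = Nat.beq ((s >>> i) &&& 1) 1 := rfl
  rw [h, Nat.and_one_is_mod, Nat.shiftRight_eq_div_pow, Nat.testBit_eq_decide_div_mod_eq,
    Bool.eq_iff_iff, Nat.beq_eq, decide_eq_true_iff]

/-- The mask of all neighbours of vertices in `s`. -/
def nbrs (s : ℕ) : List (ℕ × ℕ) → ℕ
  | [] => 0
  | (i, m) :: l => cond (bit s i) (Nat.lor m (nbrs s l)) (nbrs s l)

theorem testBit_nbrs {s i m j : ℕ} {N : List (ℕ × ℕ)} (hN : (i, m) ∈ N) (hi : s.testBit i)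
    (hj : m.testBit j) : (nbrs s N).testBit j := by
  induction N with
  | nil => simp at hN
  | cons x l ih =>
    have hor : ∀ a b : ℕ, Nat.lor a b = a ||| b := fun _ _ => rfl
    rcases List.mem_cons.1 hN with rfl | h
    · simp [nbrs, bit_eq, hi, hj]
    · rw [nbrs, hor]
      cases bit s x.1 <;> simp [ih h]

/-- Add to `s` its neighbours in `a`, repeatedly. -/
def grow (N : List (ℕ × ℕ)) (a : ℕ) : ℕ → ℕ → ℕ
  | 0, s => s
  | k + 1, s => force (Nat.lor s (Nat.land a (nbrs s N))) (grow N a k)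

/-- Unless this test succeeds, growing the lowest bit of `a` shows that `a` is disconnected. -/
def maybeConnected (N : List (ℕ × ℕ)) (a : ℕ) : Bool :=
  force (grow N a 4 (Nat.sub a (Nat.land a (Nat.sub a 1)))) fun s =>
    Nat.beq s a || (Nat.beq s 0 || (!Nat.beq (Nat.land s a) s ||
      !Nat.beq (Nat.lor s (Nat.land a (nbrs s N))) s))

/-- The number of rows satisfying `f`. -/
def count (f : ℕ × ℕ → Bool) : List (ℕ × ℕ) → ℕ
  | [] => 0
  | x :: l => cond (f x) (Nat.add (count f l) 1) (count f l)

theorem count_eq (f : ℕ × ℕ → Bool) (N : List (ℕ × ℕ)) : count f N = (N.filter f).length := by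
  induction N with
  | nil => rfl
  | cons x l ih =>
    rw [count, ih, List.filter_cons]
    cases f x <;> rfl

theorem card_le_count {ι : Type*} [Fintype ι] {f : ℕ × ℕ → Bool} {N : List (ℕ × ℕ)}
    {x : ι → ℕ × ℕ} (hx : Function.Injective x) (hN : ∀ i, x i ∈ N) (hf : ∀ i, f (x i)) :
    Fintype.card ι ≤ count f N := by
  rw [count_eq]
  have hnd : (Finset.univ.toList.map x).Nodup := (Finset.nodup_toList _).map hx
  have hsub : Finset.univ.toList.map x ⊆ N.filter f := by
    intro y hy
    obtain ⟨i, -, rfl⟩ := List.mem_map.1 hy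
    exact List.mem_filter.2 ⟨hN i, hf i⟩
  simpa using (List.subperm_of_subset hnd hsub).length_le

/-- Whether a vertex of `p` among the remaining vertices `r` lies in `q` or has a neighbour in `r`
outside `p`. -/
def live (p q r : ℕ) (x : ℕ × ℕ) : Bool :=
  bit (Nat.land p r) x.1 &&
    (bit q x.1 || !Nat.beq (Nat.land (Nat.land x.2 r) p) (Nat.land x.2 r))

/-- Necessary conditions for `a` to be the mask of one of the two large branch sets, where `f` is
the mask of all vertices. -/
def isCandidate (N : List (ℕ × ℕ)) (f a : ℕ) : Bool :=
  Nat.ble 7 (count (fun x => bit (Nat.xor f a) x.1) N) && force (nbrs a N) fun p =>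
    Nat.ble 6 (count (fun x => !bit a x.1 && bit p x.1) N) && maybeConnected N a

/-- Necessary conditions for `a` and `b` to be the masks of the two large branch sets. -/
def isCompatible (N : List (ℕ × ℕ)) (f a b : ℕ) : Bool :=
  Nat.beq (Nat.land a b) 0 &&
    force (Nat.xor f (Nat.lor a b)) fun r => force (nbrs a N) fun p => force (nbrs b N) fun q =>
      Nat.ble 6 (count (live p q r) N) && Nat.ble 6 (count (live q p r) N)

/-- Prepend to `l` all masks satisfying `f` that arise from `a` by adding vertices. -/
def collect (f : ℕ → Bool) : List (ℕ × ℕ) → ℕ → List ℕ → List ℕ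
  | [], a, l => force a fun a => cond (f a) (a :: l) l
  | x :: N, a, l => collect f N a (collect f N (Nat.lor a (Nat.pow 2 x.1)) l)

theorem subset_collect (f : ℕ → Bool) (N : List (ℕ × ℕ)) (a : ℕ) (l : List ℕ) :
    l ⊆ collect f N a l := by
  induction N generalizing a l with
  | nil =>
    rw [collect, force_eq]
    cases f a <;> simp
  | cons x N ih => exact List.Subset.trans (ih _ l) (ih _ _)

/-- The mask of all vertices of `N` satisfying `P`, added to `a`. -/
def mask (P : ℕ → Bool) : List (ℕ × ℕ) → ℕ → ℕ
  | [], a => a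
  | x :: N, a => mask P N (cond (P x.1) (a ||| 2 ^ x.1) a)

theorem testBit_mask {P : ℕ → Bool} {N : List (ℕ × ℕ)} {a i : ℕ} :
    (mask P N a).testBit i ↔ a.testBit i ∨ P i ∧ ∃ x ∈ N, x.1 = i := by
  induction N generalizing a with
  | nil => simp [mask]
  | cons x N ih =>
    rw [mask, ih]
    rcases eq_or_ne x.1 i with rfl | hi
    · cases h : P x.1 <;> simp [Nat.testBit_two_pow_self]
    · cases h : P x.1 <;> simp [hi]

theorem mask_mem_collect {f : ℕ → Bool} {P : ℕ → Bool} {N : List (ℕ × ℕ)} {a : ℕ} {l : List ℕ}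
    (h : f (mask P N a)) : mask P N a ∈ collect f N a l := by
  induction N generalizing a l with
  | nil =>
    rw [mask] at h
    simp [collect, force_eq, mask, h]
  | cons x N ih =>
    rw [mask] at h ⊢
    rw [collect]
    cases hx : P x.1
    · rw [hx] at h
      exact ih h
    · rw [hx] at h
      exact subset_collect _ _ _ _ (ih h)

/-- No two entries of the list are related by `f`. -/
def noPair (f : ℕ → ℕ → Bool) : List ℕ → Bool
  | [] => true
  | a :: l => l.all (fun b => !f a b) && noPair f l

theorem noPair_spec {f : ℕ → ℕ → Bool} {l : List ℕ} (h : noPair f l) {a b : ℕ} (ha : a ∈ l)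
    (hb : b ∈ l) (hab : a ≠ b) : f a b = false ∨ f b a = false := by
  induction l with
  | nil => simp at ha
  | cons c l ih =>
    rw [noPair, Bool.and_eq_true, List.all_eq_true] at h
    rcases List.mem_cons.1 ha with rfl | ha' <;> rcases List.mem_cons.1 hb with rfl | hb'
    · exact absurd rfl hab
    · exact Or.inl (by simpa using h.1 b hb')
    · exact Or.inr (by simpa using h.1 a ha')
    · exact ih h.2 ha' hb'

/-- The search finds no candidate for a `K_{2,6}`-minor. -/
def findsNothing (N : List (ℕ × ℕ)) (f : ℕ) : Bool :=
  noPair (isCompatible N f) (collect (isCandidate N f) N 0 [])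

section Soundness

variable {V : Type*} {G : SimpleGraph V}

/-- Branch sets of a `K_{2,6}`-minor. -/
structure Model (G : SimpleGraph V) (A B : Set V) (C : Fin 6 → Set V) : Prop where
  connected_left : IsConnectedSet G A
  connected_right : IsConnectedSet G B
  connected : ∀ i, IsConnectedSet G (C i)
  notMem : ∀ x ∈ A, x ∉ B
  notMem_left : ∀ i, ∀ x ∈ C i, x ∉ A
  notMem_right : ∀ i, ∀ x ∈ C i, x ∉ B
  eq_of_mem : ∀ i j, ∀ x ∈ C i, x ∈ C j → i = j
  adj_left : ∀ i, ∃ u ∈ A, ∃ v ∈ C i, G.Adj u v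
  adj_right : ∀ i, ∃ u ∈ B, ∃ v ∈ C i, G.Adj u v

theorem Model.symm {A B : Set V} {C : Fin 6 → Set V} (h : Model G A B C) : Model G B A C :=
  ⟨h.connected_right, h.connected_left, h.connected, fun x hB hA => h.notMem x hA hB,
    h.notMem_right, h.notMem_left, h.eq_of_mem, h.adj_right, h.adj_left⟩

/-- The rows `N` represent a supergraph of `G`, where the vertex `v` has number `c v`, and `f`
contains all vertices. -/
structure Represents (G : SimpleGraph V) (N : List (ℕ × ℕ)) (f : ℕ) (c : V → ℕ) : Prop where
  injective : Function.Injective c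
  testBit : ∀ v, f.testBit (c v)
  exists_row : ∀ u, ∃ m, (c u, m) ∈ N ∧ ∀ v, G.Adj u v → m.testBit (c v)

variable {N : List (ℕ × ℕ)} {f : ℕ} {c : V → ℕ}

open Classical in
/-- The mask of a set of vertices. -/
noncomputable def setMask (N : List (ℕ × ℕ)) (c : V → ℕ) (S : Set V) : ℕ :=
  mask (fun i => decide (∃ u ∈ S, c u = i)) N 0

theorem exists_of_testBit_setMask {S : Set V} {i : ℕ} (h : (setMask N c S).testBit i) :
    ∃ u ∈ S, c u = i := by
  rw [setMask, testBit_mask] at h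
  simpa using (h.resolve_left (by simp)).1

theorem Represents.testBit_setMask (hN : Represents G N f c) {S : Set V} {v : V} :
    (setMask N c S).testBit (c v) ↔ v ∈ S := by
  constructor
  · intro h
    obtain ⟨u, hu, huv⟩ := exists_of_testBit_setMask h
    exact hN.injective huv ▸ hu
  · intro h
    rw [setMask, testBit_mask]
    obtain ⟨m, hm, -⟩ := hN.exists_row v
    exact Or.inr ⟨by simpa using ⟨v, h, rfl⟩, _, hm, rfl⟩

theorem Represents.testBit_nbrs (hN : Represents G N f c) {s : ℕ} {u v : V}
    (hu : s.testBit (c u)) (huv : G.Adj u v) : (nbrs s N).testBit (c v) := by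
  obtain ⟨m, hm, h⟩ := hN.exists_row u
  exact MinorSearch.testBit_nbrs hm hu (h v huv)

theorem Represents.card_le_count (hN : Represents G N f c) {ι : Type*} [Fintype ι]
    {g : ℕ × ℕ → Bool} (v : ι → V) (hv : Function.Injective v)
    (hg : ∀ i m, (∀ w, G.Adj (v i) w → m.testBit (c w)) → g (c (v i), m)) :
    Fintype.card ι ≤ count g N := by
  choose m hm h using fun i => hN.exists_row (v i)
  exact MinorSearch.card_le_count (x := fun i => (c (v i), m i))
    (fun i j hij => hv (hN.injective (Prod.ext_iff.1 hij).1)) hm fun i => hg i _ (h i)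

theorem Represents.maybeConnected (hN : Represents G N f c) {S : Set V}
    (hS : IsConnectedSet G S) : maybeConnected N (setMask N c S) := by
  rw [MinorSearch.maybeConnected, force_eq]
  generalize grow N _ 4 _ = s
  set a := setMask N c S with ha
  by_contra hcon
  simp only [Bool.or_eq_true, Bool.not_eq_true', Nat.beq_eq, not_or, Bool.not_eq_false] at hcon
  obtain ⟨hsa, hs0, hsub, hclosed⟩ := hcon
  replace hsub : s &&& a = s := hsub
  replace hclosed : s ||| (a &&& nbrs s N) = s := hclosed
  have hsub' : ∀ i, s.testBit i → a.testBit i := by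
    intro i hi
    rw [← hsub, Nat.testBit_and, Bool.and_eq_true] at hi
    exact hi.2
  obtain ⟨i, hi⟩ := Nat.exists_testBit_of_ne_zero hs0
  obtain ⟨x, hx, rfl⟩ := exists_of_testBit_setMask (hsub' i hi)
  obtain ⟨y, hy, hys⟩ : ∃ y ∈ S, ¬ s.testBit (c y) := by
    by_contra hall
    push Not at hall
    refine hsa (Nat.eq_of_testBit_eq fun j => Bool.eq_iff_iff.2 ⟨hsub' j, fun hj => ?_⟩)
    obtain ⟨y, hy, rfl⟩ := exists_of_testBit_setMask hj
    exact hall y hy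
  obtain ⟨u, -, hus, v, hv, hvs, huv⟩ :=
    hS.2 {z | s.testBit (c z)} ⟨x, hx, hi⟩ ⟨y, hy, hys⟩
  refine hvs ?_
  rw [Set.mem_ofPred_eq, ← hclosed]
  simp [hN.testBit_nbrs hus huv, hN.testBit_setMask.2 hv, ha]

variable {A B : Set V} {C : Fin 6 → Set V}

theorem Model.injective (h : Model G A B C) {v : Fin 6 → V} (hv : ∀ i, v i ∈ C i) :
    Function.Injective v := fun i j hij => h.eq_of_mem i j (v i) (hv i) (hij ▸ hv j)

theorem Model.isCandidate (h : Model G A B C) (hN : Represents G N f c) :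
    isCandidate N f (setMask N c A) := by
  have hA : ∀ v, v ∉ A → (setMask N c A).testBit (c v) = false := fun v hv => by
    rwa [← Bool.not_eq_true, hN.testBit_setMask]
  choose u hu v hv huv using h.adj_left
  rw [MinorSearch.isCandidate, force_eq]
  simp only [Bool.and_eq_true, Nat.ble_eq]
  refine ⟨?_, ?_, hN.maybeConnected h.connected_left⟩
  · obtain ⟨b, hb⟩ := h.connected_right.1
    have hxor : ∀ v, v ∉ A → (Nat.xor f (setMask N c A)).testBit (c v) := by
      intro v hv
      change (f ^^^ setMask N c A).testBit (c v)
      simp [hN.testBit v, hA v hv]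
    have hinj : Function.Injective fun o : Option (Fin 6) => o.elim b v := by
      rintro (_ | i) (_ | j) hij
      · rfl
      · replace hij : b = v j := hij
        exact absurd hb (h.notMem_right j _ (hij ▸ hv j))
      · replace hij : v i = b := hij
        exact absurd hb (h.notMem_right i _ (hij ▸ hv i))
      · exact congrArg some (h.injective hv hij)
    refine hN.card_le_count (ι := Option (Fin 6)) _ hinj ?_
    rintro (_ | i) m -
    · rw [bit_eq]
      exact hxor b fun hbA => h.notMem _ hbA hb
    · rw [bit_eq]
      exact hxor (v i) (h.notMem_left i _ (hv i))
  · refine hN.card_le_count (ι := Fin 6) v (h.injective hv) fun i m _ => ?_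
    simp [bit_eq, hA _ (h.notMem_left i _ (hv i)),
      hN.testBit_nbrs (hN.testBit_setMask.2 (hu i)) (huv i)]

/-- Each small branch set contains a vertex in `p`, the neighbours of `A`, that lies in `q`, the
neighbours of `B`, or has a neighbour outside `p`. -/
theorem Model.six_le_count_live (h : Model G A B C) (hN : Represents G N f c) {r : ℕ}
    (hr : ∀ i, ∀ v ∈ C i, r.testBit (c v)) :
    6 ≤ count (live (nbrs (setMask N c A) N) (nbrs (setMask N c B) N) r) N := by
  generalize hp : nbrs (setMask N c A) N = p
  generalize hq : nbrs (setMask N c B) N = q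
  have key : ∀ i, ∃ v ∈ C i, p.testBit (c v) ∧
      (q.testBit (c v) ∨ ∃ w ∈ C i, ¬ p.testBit (c w) ∧ G.Adj v w) := by
    intro i
    obtain ⟨u, hu, v, hv, huv⟩ := h.adj_left i
    obtain ⟨u', hu', v', hv', huv'⟩ := h.adj_right i
    have hvp : p.testBit (c v) := hp ▸ hN.testBit_nbrs (hN.testBit_setMask.2 hu) huv
    have hvq : q.testBit (c v') := hq ▸ hN.testBit_nbrs (hN.testBit_setMask.2 hu') huv'
    by_cases hvp' : p.testBit (c v')
    · exact ⟨v', hv', hvp', Or.inl hvq⟩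
    · obtain ⟨x, hx, hxp, y, hy, hyp, hxy⟩ :=
        (h.connected i).2 {z | p.testBit (c z)} ⟨v, hv, hvp⟩ ⟨v', hv', hvp'⟩
      exact ⟨x, hx, hxp, Or.inr ⟨y, hy, hyp, hxy⟩⟩
  choose v hv hvp hvq using key
  refine hN.card_le_count (ι := Fin 6) v (h.injective hv) fun i m hm => ?_
  have hand : ∀ a b : ℕ, Nat.land a b = a &&& b := fun _ _ => rfl
  simp only [live, bit_eq, hand, Nat.testBit_and, hvp i, hr i _ (hv i), Bool.true_and,
    Bool.or_eq_true, Bool.not_eq_true', ← Bool.not_eq_true, Nat.beq_eq]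
  refine (hvq i).imp_right ?_
  rintro ⟨w, hw, hwp, hvw⟩ heq
  have := congrArg (fun s => s.testBit (c w)) heq
  simp [hm w hvw, hr i w hw] at this
  exact hwp this

theorem Model.isCompatible (h : Model G A B C) (hN : Represents G N f c) :
    isCompatible N f (setMask N c A) (setMask N c B) := by
  have hr : ∀ i, ∀ v ∈ C i,
      (Nat.xor f (Nat.lor (setMask N c A) (setMask N c B))).testBit (c v) := by
    intro i v hv
    change (f ^^^ (setMask N c A ||| setMask N c B)).testBit (c v)
    have hA := mt hN.testBit_setMask.1 (h.notMem_left i v hv)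
    have hB := mt hN.testBit_setMask.1 (h.notMem_right i v hv)
    simp [hN.testBit v, hA, hB]
  have hdisj : setMask N c A &&& setMask N c B = 0 := by
    refine Nat.eq_of_testBit_eq fun i => ?_
    rw [Nat.zero_testBit, Nat.testBit_and, ← Bool.not_eq_true, Bool.and_eq_true]
    rintro ⟨hA, hB⟩
    obtain ⟨u, hu, rfl⟩ := exists_of_testBit_setMask hA
    exact h.notMem u hu (hN.testBit_setMask.1 hB)
  simp only [MinorSearch.isCompatible, force_eq, Bool.and_eq_true, Nat.beq_eq, Nat.ble_eq]
  exact ⟨hdisj, h.six_le_count_live hN hr, h.symm.six_le_count_live hN hr⟩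

theorem Represents.not_hasMinor (hN : Represents G N f c) (hf : findsNothing N f) :
    ¬ HasMinor G (completeBipartiteGraph (Fin 2) (Fin 6)) := by
  intro hG
  obtain ⟨B, hB⟩ := hasMinor_iff.1 hG
  have h : Model G (B (Sum.inl 0)) (B (Sum.inl 1)) fun i => B (Sum.inr i) := by
    refine ⟨hB.connected _, hB.connected _, fun i => hB.connected _, ?_, ?_, ?_, ?_, ?_, ?_⟩
    · exact fun x h₀ h₁ => absurd (hB.eq_of_mem h₀ h₁) (by simp)
    · exact fun i x h₀ h₁ => absurd (hB.eq_of_mem h₀ h₁) (by simp)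
    · exact fun i x h₀ h₁ => absurd (hB.eq_of_mem h₀ h₁) (by simp)
    · exact fun i j x h₀ h₁ => Sum.inr.inj (hB.eq_of_mem h₀ h₁)
    · exact fun i => hB.adj (by simp)
    · exact fun i => hB.adj (by simp)
  have hne : setMask N c (B (Sum.inl 0)) ≠ setMask N c (B (Sum.inl 1)) := by
    intro heq
    obtain ⟨x, hx⟩ := h.connected_left.1
    exact h.notMem x hx (hN.testBit_setMask.1 (heq ▸ hN.testBit_setMask.2 hx))
  rcases noPair_spec hf (mask_mem_collect (h.isCandidate hN))
    (mask_mem_collect (h.symm.isCandidate hN)) hne with h' | h'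
  · exact Bool.false_ne_true (h'.symm.trans (h.isCompatible hN))
  · exact Bool.false_ne_true (h'.symm.trans (h.symm.isCompatible hN))

end Soundness

end MinorSearch

/-- The neighbourhoods in `GBullet 11`. -/
def rows11 : List (ℕ × ℕ) :=
  [(0, 224), (1, 1812), (2, 1466), (3, 884), (4, 1742), (5, 13),
   (6, 25), (7, 21), (8, 14), (9, 26), (10, 22)]

/-- The neighbourhoods in `GBullet 12`. -/
def rows12 : List (ℕ × ℕ) :=
  [(0, 224), (1, 3860), (2, 1466), (3, 884), (4, 2766), (5, 13),
   (6, 25), (7, 21), (8, 14), (9, 26), (10, 2054), (11, 1042)]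

/-- The number of a vertex in `rows11` and `rows12`. -/
def vertexCode {m : ℕ} : Fin 10 ⊕ Fin m → ℕ
  | Sum.inl i => i
  | Sum.inr k => 10 + k

theorem vertexCode_injective {m : ℕ} : Function.Injective (vertexCode (m := m)) := by
  rintro (i | k) (j | l) h <;> simp only [vertexCode] at h
  · rw [Fin.ext h]
  · omega
  · omega
  · rw [Fin.ext (Nat.add_left_cancel h)]

open MinorSearch in
theorem gBullet_eleven_not_hasMinor :
    ¬ HasMinor (GBullet 11) (completeBipartiteGraph (Fin 2) (Fin 6)) := by
  have hrows : ∀ u : Fin 10 ⊕ Fin (11 - 10), ∃ x ∈ rows11, x.1 = vertexCode u ∧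
      ∀ v, (GBullet 11).Adj u v → x.2.testBit (vertexCode v) := by decide +kernel
  refine Represents.not_hasMinor (N := rows11) (f := 2047) (c := vertexCode)
    ⟨vertexCode_injective, by decide +kernel, fun u => ?_⟩ (by decide +kernel)
  obtain ⟨⟨_, m⟩, hx, rfl, h⟩ := hrows u
  exact ⟨m, hx, h⟩

open MinorSearch in
theorem gBullet_twelve_not_hasMinor :
    ¬ HasMinor (GBullet 12) (completeBipartiteGraph (Fin 2) (Fin 6)) := by
  have hrows : ∀ u : Fin 10 ⊕ Fin (12 - 10), ∃ x ∈ rows12, x.1 = vertexCode u ∧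
      ∀ v, (GBullet 12).Adj u v → x.2.testBit (vertexCode v) := by decide +kernel
  refine Represents.not_hasMinor (N := rows12) (f := 4095) (c := vertexCode)
    ⟨vertexCode_injective, by decide +kernel, fun u => ?_⟩ (by decide +kernel)
  obtain ⟨⟨_, m⟩, hx, rfl, h⟩ := hrows u
  exact ⟨m, hx, h⟩

theorem gBullet_no_K26_minor (n : ℕ) (hn : 11 ≤ n) :
    ¬ HasMinor (GBullet n) (completeBipartiteGraph (Fin 2) (Fin 6)) := by
  induction n, hn using Nat.le_induction with
  | base => exact gBullet_eleven_not_hasMinor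
  | succ n hn ih =>
    rcases hn.eq_or_lt with rfl | hn
    · exact gBullet_twelve_not_hasMinor
    · exact not_hasMinor_gBullet_succ hn ih
end

section
/- For every integer n ≥ 13, the graph G_n^∘ does not contain the complete bipartite graph K_{2,6} as a minor. -/
/-- Labels in `Fin 12`: `0 = h¹`, `1 = h²`, `2 = h₁`, `3 = h₂`, `4 = h₃`,
`5 = h₁¹`, `6 = h₂¹`, `7 = h₃¹`, `8 = h₁²`, `9 = h₂²`, `10 = t₁`, `11 = t₂`.
The edges among these vertices, including the five dashed edges. -/
def circBase : List (Fin 12 × Fin 12) :=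
  [(0,10),(10,5),(0,11),(11,6),(10,11),(0,7),
   (1,8),(1,9),
   (2,5),(2,8),(2,7),
   (3,5),(3,8),(3,6),(3,9),
   (4,6),(4,9),(4,7),
   (2,3),(3,4),(4,2),(2,1),(4,1)]

/-- The graph `G_n^∘` for `n ≥ 13`.  The vertex `Sum.inr k` is `v_{k+1}`,
for `0 ≤ k ≤ n - 13`, so that `v₁ = Sum.inr 0` and `v_{n-12} = Sum.inr (n-13)`. -/
def GCirc (n : ℕ) : SimpleGraph (Fin 12 ⊕ Fin (n - 12)) :=
  SimpleGraph.fromRel (fun a b =>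
    match a, b with
    | Sum.inl i, Sum.inl j => (i, j) ∈ circBase
    | Sum.inl i, Sum.inr k =>
        (i = 2 ∧ (k : ℕ) = 0) ∨ (i = 4 ∧ (k : ℕ) = n - 13) ∨ i = 1
    | Sum.inr _, Sum.inl _ => False
    | Sum.inr k, Sum.inr l => (l : ℕ) = (k : ℕ) + 1)

/-- The bitwise difference of two masks. -/
def maskDiff (a b : ℕ) : ℕ := a ^^^ (a &&& b)

/-- The number of ones among the lowest `k` bits of a mask. -/
def popCount : ℕ → ℕ → ℕ
  | 0, _ => 0
  | k + 1, s => s % 2 + popCount k (s / 2)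

/-- The mask of the neighbours of the `i`-th vertex of `circBase`. -/
def baseRow (i : ℕ) : ℕ :=
  [3200, 788, 442, 884, 718, 1036, 2072, 21, 14, 26, 2081, 1089].getD i 0

/-- Checks `p` on all connected vertex sets of `circBase` that contain the mask `b`, have
neighbour mask `nb`, and are contained in `b ||| av`, except those containing a mask
satisfying the pruning criterion `q`. -/
def checkConnected (p : ℕ → ℕ → Bool) (q : ℕ → Bool) : ℕ → ℕ → ℕ → ℕ → Bool
  | 0, _, _, _ => false
  | k + 1, b, nb, av =>
    q b ||
      let f := if b = 0 then av else nb &&& av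
      if f = 0 then b == 0 || p b nb
      else
        checkConnected p q k (b ||| 1 <<< f.log2) (nb ||| baseRow f.log2)
            (maskDiff av (1 <<< f.log2)) &&
          checkConnected p q k b nb (maskDiff av (1 <<< f.log2))

/-- An upper bound for the number of common neighbours on the path of `GCirc n` of two
disjoint connected sets whose traces on `circBase` have masks `a` and `b`. -/
def pathBonus (a b : ℕ) : ℕ :=
  if a.testBit 1 then (b.testBit 2).toNat + (b.testBit 4).toNat
  else if b.testBit 1 then (a.testBit 2).toNat + (a.testBit 4).toNat
  else ((a.testBit 2 && b.testBit 4) || (a.testBit 4 && b.testBit 2)).toNat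

/-- Checks that the vertex set of `circBase` with mask `a` and neighbour mask `na` and a connected
set disjoint from it never have six common neighbours, counting `pathBonus`. -/
def checkPartners (a na : ℕ) : Bool :=
  checkConnected
    (fun b nb => popCount 12 (maskDiff (maskDiff na a) b &&& nb) + pathBonus a b < 6)
    (fun b => popCount 12 (maskDiff (maskDiff na a) b) < 4)
    13 0 0 (maskDiff 4095 a)

/-- Checks `checkPartners` for all connected vertex sets with at most four vertices. -/
def checkBase : Bool :=
  checkConnected checkPartners (fun a => 4 < popCount 12 a) 13 0 0 4095

theorem checkBase_eq_true : checkBase = true := by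
  decide +kernel

/-- Adjacency in the graph with edge list `circBase`. -/
def BaseAdj (i j : Fin 12) : Prop := (i, j) ∈ circBase ∨ (j, i) ∈ circBase

instance : DecidableRel BaseAdj := fun _ _ => inferInstanceAs (Decidable (_ ∨ _))

theorem BaseAdj.symm {i j : Fin 12} (h : BaseAdj i j) : BaseAdj j i := Or.symm h

/-- A nonempty set none of whose proper nonempty subsets is closed under `r` within the set. -/
def CutConnected {α : Type*} (r : α → α → Prop) (S : Set α) : Prop :=
  S.Nonempty ∧ ∀ T ⊆ S, T.Nonempty → (∀ u ∈ T, ∀ v ∈ S, r u v → v ∈ T) → T = S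

/-- The bit mask of a set of vertices of `circBase`. -/
def mask (S : Finset (Fin 12)) : ℕ := Nat.ofBits fun i => decide (i ∈ S)

theorem testBit_mask (S : Finset (Fin 12)) (i : ℕ) :
    (mask S).testBit i = decide (∃ h : i < 12, (⟨i, h⟩ : Fin 12) ∈ S) := by
  by_cases h : i < 12
  · simp [mask, h]
  · simp [mask, h, Nat.testBit_ofBits_ge _ _ (not_lt.1 h)]

@[simp] theorem testBit_mask_val (S : Finset (Fin 12)) (i : Fin 12) :
    (mask S).testBit i = decide (i ∈ S) := by
  simp [testBit_mask]

theorem mask_and (S T : Finset (Fin 12)) : mask S &&& mask T = mask (S ∩ T) := by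
  refine Nat.eq_of_testBit_eq fun i => ?_
  rw [Nat.testBit_and]
  by_cases h : i < 12 <;> simp [testBit_mask, h]

theorem mask_or (S T : Finset (Fin 12)) : mask S ||| mask T = mask (S ∪ T) := by
  refine Nat.eq_of_testBit_eq fun i => ?_
  rw [Nat.testBit_or]
  by_cases h : i < 12 <;> simp [testBit_mask, h]

theorem maskDiff_mask (S T : Finset (Fin 12)) : maskDiff (mask S) (mask T) = mask (S \ T) := by
  refine Nat.eq_of_testBit_eq fun i => ?_
  rw [maskDiff, Nat.testBit_xor, Nat.testBit_and]
  by_cases h : i < 12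
  · by_cases hS : (⟨i, h⟩ : Fin 12) ∈ S <;> by_cases hT : (⟨i, h⟩ : Fin 12) ∈ T <;>
      simp [testBit_mask, h, hS, hT]
  · simp [testBit_mask, h]

theorem mask_singleton (i : Fin 12) : 1 <<< (i : ℕ) = mask {i} := by
  revert i; decide

theorem mask_empty : mask ∅ = 0 := by decide

theorem mask_univ : mask Finset.univ = 4095 := by decide

theorem mask_eq_zero {S : Finset (Fin 12)} : mask S = 0 ↔ S = ∅ := by
  refine ⟨fun h => Finset.eq_empty_of_forall_notMem fun i hi => ?_, fun h => h ▸ mask_empty⟩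
  have := testBit_mask_val S i
  simp [h, hi] at this

theorem exists_log2_mask {S : Finset (Fin 12)} (h : mask S ≠ 0) :
    ∃ i ∈ S, (mask S).log2 = (i : ℕ) := by
  have := Nat.testBit_log2 h
  rw [testBit_mask, decide_eq_true_iff] at this
  obtain ⟨hi, hS⟩ := this
  exact ⟨_, hS, rfl⟩

theorem popCount_eq_sum (k s : ℕ) :
    popCount k s = ∑ i : Fin k, (s.testBit i).toNat := by
  induction k generalizing s with
  | zero => simp [popCount]
  | succ k ih =>
    rw [popCount, ih, Fin.sum_univ_succ]
    simp [Nat.testBit_succ, Nat.testBit_zero]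
    rcases Nat.mod_two_eq_zero_or_one s with h | h <;> simp [h]

theorem popCount_mask (S : Finset (Fin 12)) : popCount 12 (mask S) = S.card := by
  simp [popCount_eq_sum, Bool.toNat, Bool.cond_decide]

/-- The neighbourhood of a set of vertices of `circBase`. -/
def baseNbrs (S : Finset (Fin 12)) : Finset (Fin 12) :=
  Finset.univ.filter fun i => ∃ j ∈ S, BaseAdj j i

theorem mem_baseNbrs {S : Finset (Fin 12)} {i : Fin 12} :
    i ∈ baseNbrs S ↔ ∃ j ∈ S, BaseAdj j i := by
  simp [baseNbrs]

theorem baseRow_eq (i : Fin 12) : baseRow i = mask (baseNbrs {i}) := by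
  revert i; decide +kernel

theorem baseNbrs_union (S T : Finset (Fin 12)) :
    baseNbrs (S ∪ T) = baseNbrs S ∪ baseNbrs T := by
  ext i
  simp only [mem_baseNbrs, Finset.mem_union, or_and_right, exists_or]

theorem baseNbrs_empty : baseNbrs ∅ = ∅ := by decide

theorem of_checkConnected {p : ℕ → ℕ → Bool} {q : ℕ → Bool} {S : Finset (Fin 12)}
    (hS : CutConnected BaseAdj (S : Set (Fin 12)))
    (hq : ∀ B ⊆ S, q (mask B) = false) (k : ℕ) (B V : Finset (Fin 12))
    (hB : B ⊆ S) (hV : S ⊆ B ∪ V)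
    (h : checkConnected p q k (mask B) (mask (baseNbrs B)) (mask V) = true) :
    p (mask S) (mask (baseNbrs S)) = true := by
  induction k generalizing B V with
  | zero => simp [checkConnected] at h
  | succ k ih =>
    rw [checkConnected, hq B hB, Bool.false_or] at h
    obtain ⟨F, hF, hFV, hF0⟩ : ∃ F : Finset (Fin 12),
        (if mask B = 0 then mask V else mask (baseNbrs B) &&& mask V) = mask F ∧ F ⊆ V ∧
        (F = ∅ → B = S) := by
      by_cases hB0 : mask B = 0
      · refine ⟨V, by simp [hB0], subset_rfl, fun hV0 => ?_⟩
        obtain ⟨i, hi⟩ := hS.1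
        have := hV hi
        simp [hV0, mask_eq_zero.1 hB0] at this
      · refine ⟨baseNbrs B ∩ V, by simp [hB0, mask_and], Finset.inter_subset_right, fun hE => ?_⟩
        refine Finset.coe_injective (hS.2 B (Finset.coe_subset.2 hB) ?_ fun u hu v hv huv => ?_)
        · exact Finset.coe_nonempty.2 (Finset.nonempty_iff_ne_empty.2 fun h => hB0 (mask_eq_zero.2 h))
        · rcases Finset.mem_union.1 (hV hv) with h | h
          · exact h
          · have : v ∈ baseNbrs B ∩ V := Finset.mem_inter.2 ⟨mem_baseNbrs.2 ⟨u, hu, huv⟩, h⟩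
            simp [hE] at this
    simp only [hF] at h
    split_ifs at h with hf
    · obtain rfl := hF0 (mask_eq_zero.1 hf)
      obtain ⟨i, hi⟩ := hS.1
      have hB0 : mask B ≠ 0 := fun h => by simp [mask_eq_zero.1 h] at hi
      simpa [hB0] using h
    · obtain ⟨i, hi, hlog⟩ := exists_log2_mask hf
      rw [hlog, mask_singleton, baseRow_eq, mask_or, mask_or, maskDiff_mask, ← baseNbrs_union,
        Bool.and_eq_true] at h
      by_cases hiS : i ∈ S
      · refine ih _ _ ?_ ?_ h.1
        · exact Finset.union_subset hB (Finset.singleton_subset_iff.2 hiS)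
        · intro j hj
          have := hV hj
          simp only [Finset.mem_union, Finset.mem_sdiff, Finset.mem_singleton] at this ⊢
          tauto
      · refine ih _ _ hB ?_ h.2
        intro j hj
        have := hV hj
        have hji : j ≠ i := fun h => hiS (h ▸ hj)
        simp only [Finset.mem_union, Finset.mem_sdiff, Finset.mem_singleton] at this ⊢
        tauto

theorem of_checkConnected_zero {p : ℕ → ℕ → Bool} {q : ℕ → Bool} {S : Finset (Fin 12)}
    (hS : CutConnected BaseAdj (S : Set (Fin 12)))
    (hq : ∀ B ⊆ S, q (mask B) = false) (k : ℕ) (V : Finset (Fin 12)) (hV : S ⊆ V)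
    (h : checkConnected p q k 0 0 (mask V) = true) :
    p (mask S) (mask (baseNbrs S)) = true :=
  of_checkConnected hS hq k ∅ V (Finset.empty_subset S) (by simpa using hV)
    (by rwa [baseNbrs_empty, mask_empty])

theorem pathBonus_le (a b : ℕ) : pathBonus a b ≤ 2 := by
  unfold pathBonus
  have h (x : Bool) : x.toNat ≤ 1 := Bool.toNat_le x
  split_ifs
  · exact add_le_add (h _) (h _)
  · exact add_le_add (h _) (h _)
  · exact (h _).trans one_le_two

theorem pathBonus_comm {A B : Finset (Fin 12)} (h : Disjoint A B) :
    pathBonus (mask A) (mask B) = pathBonus (mask B) (mask A) := by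
  have h1 : ¬ (1 ∈ A ∧ 1 ∈ B) := fun h' => Finset.disjoint_left.1 h h'.1 h'.2
  unfold pathBonus
  by_cases hA : (mask A).testBit 1 <;> by_cases hB : (mask B).testBit 1
  · exact absurd ⟨by simpa [testBit_mask] using hA, by simpa [testBit_mask] using hB⟩ h1
  all_goals simp [hA, hB, Bool.and_comm, Bool.or_comm]

theorem card_commonNbrs_add_pathBonus_lt_of_card_le {A B : Finset (Fin 12)}
    (hA : CutConnected BaseAdj (A : Set (Fin 12))) (hB : CutConnected BaseAdj (B : Set (Fin 12)))
    (hAB : Disjoint A B) (hcard : A.card ≤ 4) :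
    (((baseNbrs A \ A) \ B) ∩ baseNbrs B).card + pathBonus (mask A) (mask B) < 6 := by
  by_contra! hlt
  have houter := checkBase_eq_true
  rw [checkBase, ← mask_univ] at houter
  have hinner : checkPartners (mask A) (mask (baseNbrs A)) = true := by
    refine of_checkConnected_zero hA (fun C hC => ?_) _ _ (Finset.subset_univ A) houter
    rw [popCount_mask, decide_eq_false_iff_not, not_lt]
    exact (Finset.card_le_card hC).trans hcard
  rw [checkPartners, ← mask_univ, maskDiff_mask, maskDiff_mask] at hinner
  have hcheck := of_checkConnected_zero hB (fun C hC => ?_) _ _ ?_ hinner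
  · rw [maskDiff_mask, mask_and, popCount_mask, decide_eq_true_iff] at hcheck
    omega
  · rw [maskDiff_mask, popCount_mask, decide_eq_false_iff_not, not_lt]
    have h1 := Finset.card_le_card (show ((baseNbrs A \ A) \ B) ∩ baseNbrs B ⊆ (baseNbrs A \ A) \ C
      from Finset.inter_subset_left.trans (Finset.sdiff_subset_sdiff le_rfl hC))
    have h2 := pathBonus_le (mask A) (mask B)
    omega
  · intro i hi
    simp [Finset.disjoint_right.1 hAB hi]

theorem card_add_pathBonus_lt {A B C : Finset (Fin 12)}
    (hA : CutConnected BaseAdj (A : Set (Fin 12))) (hB : CutConnected BaseAdj (B : Set (Fin 12)))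
    (hAB : Disjoint A B)
    (hC : ∀ c ∈ C, c ∉ A ∧ c ∉ B ∧ (∃ a ∈ A, BaseAdj a c) ∧ ∃ b ∈ B, BaseAdj b c) :
    C.card + pathBonus (mask A) (mask B) < 6 := by
  wlog h : A.card ≤ 4 generalizing A B
  · by_cases h' : B.card ≤ 4
    · rw [pathBonus_comm hAB]
      exact this hB hA hAB.symm (fun c hc => ⟨(hC c hc).2.1, (hC c hc).1, (hC c hc).2.2.symm⟩) h'
    · have h1 := Finset.card_union_of_disjoint hAB
      have h2 : Disjoint (A ∪ B) C := by
        rw [Finset.disjoint_right]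
        intro c hc
        simp [(hC c hc).1, (hC c hc).2.1]
      have h3 := Finset.card_union_of_disjoint h2
      have h4 := Finset.card_le_univ (A ∪ B ∪ C)
      have h5 := pathBonus_le (mask A) (mask B)
      simp only [Fintype.card_fin] at h4
      omega
  · refine lt_of_le_of_lt (Nat.add_le_add_right (Finset.card_le_card fun c hc => ?_) _)
      (card_commonNbrs_add_pathBonus_lt_of_card_le hA hB hAB h)
    simp only [Finset.mem_inter, Finset.mem_sdiff, mem_baseNbrs]
    exact ⟨⟨⟨(hC c hc).2.2.1, (hC c hc).1⟩, (hC c hc).2.1⟩, (hC c hc).2.2.2⟩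

theorem gCirc_adj_inl_inl {n : ℕ} {i j : Fin 12} :
    (GCirc n).Adj (Sum.inl i) (Sum.inl j) ↔ BaseAdj i j := by
  have hirr : ∀ i : Fin 12, ¬ BaseAdj i i := by decide
  simp only [GCirc, SimpleGraph.fromRel_adj, ne_eq, Sum.inl.injEq]
  exact ⟨fun h => h.2, fun h => ⟨fun hij => hirr j (hij ▸ h), h⟩⟩

theorem gCirc_adj_inl_inr {n : ℕ} {i : Fin 12} {k : Fin (n - 12)} :
    (GCirc n).Adj (Sum.inl i) (Sum.inr k) ↔
      (i = 2 ∧ (k : ℕ) = 0) ∨ (i = 4 ∧ (k : ℕ) = n - 13) ∨ i = 1 := by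
  simp [GCirc, SimpleGraph.fromRel_adj]

theorem gCirc_adj_inr_inr {n : ℕ} {k l : Fin (n - 12)} :
    (GCirc n).Adj (Sum.inr k) (Sum.inr l) ↔ (l : ℕ) = k + 1 ∨ (k : ℕ) = l + 1 := by
  simp only [GCirc, SimpleGraph.fromRel_adj, ne_eq, Sum.inr.injEq, Fin.ext_iff]
  omega

section Trace

variable {n : ℕ}

/-- The set `A` contains `h₁` and all path vertices before the `k`-th one. -/
def LeftSegment (A : Set (Fin 12 ⊕ Fin (n - 12))) (k : Fin (n - 12)) : Prop :=
  Sum.inl 2 ∈ A ∧ ∀ j < k, Sum.inr j ∈ A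

/-- The set `A` contains `h₃` and all path vertices after the `k`-th one. -/
def RightSegment (A : Set (Fin 12 ⊕ Fin (n - 12))) (k : Fin (n - 12)) : Prop :=
  Sum.inl 4 ∈ A ∧ ∀ j > k, Sum.inr j ∈ A

variable {A B : Set (Fin 12 ⊕ Fin (n - 12))}

/-- The vertices of `A` that are joined in `A` to the set `T` of vertices of `circBase`, provided
`h²` is not in `A` and `T` is closed under adjacency in `A`. -/
def pathLift (A : Set (Fin 12 ⊕ Fin (n - 12))) (T : Set (Fin 12)) :
    Set (Fin 12 ⊕ Fin (n - 12)) :=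
  {x ∈ A | Sum.elim (fun i => i ∈ T)
    (fun k => (LeftSegment A k ∧ 2 ∈ T) ∨ (RightSegment A k ∧ 4 ∈ T)) x}

theorem pathLift_eq (hA : CutConnected (GCirc n).Adj A) (h1 : Sum.inl 1 ∉ A) {T : Set (Fin 12)}
    (hT : ∀ i ∈ T, Sum.inl i ∈ A) (hne : T.Nonempty)
    (hcl : ∀ i ∈ T, ∀ j, Sum.inl j ∈ A → BaseAdj i j → j ∈ T) : pathLift A T = A := by
  have h24 : BaseAdj 2 4 := by decide
  obtain ⟨i₀, hi₀⟩ := hne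
  refine hA.2 _ (fun x hx => hx.1) ⟨Sum.inl i₀, hT _ hi₀, hi₀⟩ ?_
  rintro (i | k) ⟨hu, hu'⟩ (j | l) hv hadj <;> refine ⟨hv, ?_⟩ <;>
    simp only [Sum.elim_inl, Sum.elim_inr] at hu' ⊢
  · exact hcl i hu' j hv (gCirc_adj_inl_inl.1 hadj)
  · rcases gCirc_adj_inl_inr.1 hadj with ⟨rfl, hl⟩ | ⟨rfl, hl⟩ | rfl
    · exact Or.inl ⟨⟨hu, fun j hj => by omega⟩, hu'⟩
    · exact Or.inr ⟨⟨hu, fun j hj => by omega⟩, hu'⟩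
    · exact absurd hu h1
  · rcases gCirc_adj_inl_inr.1 hadj.symm with ⟨rfl, hl⟩ | ⟨rfl, hl⟩ | rfl
    · rcases hu' with h | h
      · exact h.2
      · exact hcl 4 h.2 2 hv h24.symm
    · rcases hu' with h | h
      · exact hcl 2 h.2 4 hv h24
      · exact h.2
    · exact absurd hv h1
  · rw [gCirc_adj_inr_inr] at hadj
    refine hu'.imp (And.imp_left fun h => ⟨h.1, fun j hj => ?_⟩)
      (And.imp_left fun h => ⟨h.1, fun j hj => ?_⟩)
    · by_cases hjk : j = k
      · exact hjk ▸ hu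
      · exact h.2 j (by omega)
    · by_cases hjk : j = k
      · exact hjk ▸ hu
      · exact h.2 j (by omega)

theorem leftSegment_or_rightSegment_of_mem (hA : CutConnected (GCirc n).Adj A)
    (h1 : Sum.inl 1 ∉ A) (hne : ∃ i, Sum.inl i ∈ A) {k : Fin (n - 12)} (hk : Sum.inr k ∈ A) :
    LeftSegment A k ∨ RightSegment A k := by
  rw [← pathLift_eq hA h1 (T := {i | Sum.inl i ∈ A}) (fun _ hi => hi) hne
    (fun _ _ _ hj _ => hj)] at hk
  exact hk.2.imp And.left And.left

theorem CutConnected.trace (hA : CutConnected (GCirc n).Adj A) (hne : ∃ i, Sum.inl i ∈ A) :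
    CutConnected BaseAdj {i | Sum.inl i ∈ A} := by
  refine ⟨hne, fun T hT hTne hcl => subset_antisymm hT fun i hi => ?_⟩
  by_cases h1 : Sum.inl 1 ∈ A
  · have h12 : BaseAdj 1 2 := by decide
    have h14 : BaseAdj 1 4 := by decide
    have hlift : {x ∈ A | Sum.elim (fun i => i ∈ T) (fun _ => 1 ∈ T) x} = A := by
      obtain ⟨i₀, hi₀⟩ := hTne
      refine hA.2 _ (fun x hx => hx.1) ⟨Sum.inl i₀, hT hi₀, hi₀⟩ ?_
      rintro (i | k) ⟨hu, hu'⟩ (j | l) hv hadj <;> refine ⟨hv, ?_⟩ <;>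
        simp only [Sum.elim_inl, Sum.elim_inr] at hu' ⊢
      · exact hcl i hu' j hv (gCirc_adj_inl_inl.1 hadj)
      · rcases gCirc_adj_inl_inr.1 hadj with ⟨rfl, -⟩ | ⟨rfl, -⟩ | rfl
        · exact hcl 2 hu' 1 h1 h12.symm
        · exact hcl 4 hu' 1 h1 h14.symm
        · exact hu'
      · rcases gCirc_adj_inl_inr.1 hadj.symm with ⟨rfl, -⟩ | ⟨rfl, -⟩ | rfl
        · exact hcl 1 hu' 2 hv h12
        · exact hcl 1 hu' 4 hv h14
        · exact hu'
      · exact hu'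
    rw [Set.mem_ofPred_eq, ← hlift] at hi
    exact hi.2
  · rw [Set.mem_ofPred_eq, ← pathLift_eq hA h1 (fun _ hi => hT hi) hTne hcl] at hi
    exact hi.2

theorem exists_baseAdj_of_adj (hA : CutConnected (GCirc n).Adj A) (hne : ∃ i, Sum.inl i ∈ A)
    {i : Fin 12} (hi : Sum.inl i ∉ A) {a : Fin 12 ⊕ Fin (n - 12)} (ha : a ∈ A)
    (hadj : (GCirc n).Adj a (Sum.inl i)) : ∃ j, Sum.inl j ∈ A ∧ BaseAdj j i := by
  obtain j | k := a
  · exact ⟨j, ha, gCirc_adj_inl_inl.1 hadj⟩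
  by_cases h1 : Sum.inl 1 ∈ A
  · refine ⟨1, h1, ?_⟩
    rcases gCirc_adj_inl_inr.1 hadj.symm with ⟨rfl, -⟩ | ⟨rfl, -⟩ | rfl
    · decide
    · decide
    · exact absurd h1 hi
  · have h2 : i ≠ 2 → BaseAdj 2 i := by
      rcases gCirc_adj_inl_inr.1 hadj.symm with ⟨rfl, -⟩ | ⟨rfl, -⟩ | rfl <;> decide
    have h4 : i ≠ 4 → BaseAdj 4 i := by
      rcases gCirc_adj_inl_inr.1 hadj.symm with ⟨rfl, -⟩ | ⟨rfl, -⟩ | rfl <;> decide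
    rcases leftSegment_or_rightSegment_of_mem hA h1 hne ha with h | h
    · exact ⟨2, h.1, h2 fun hi2 => hi (hi2 ▸ h.1)⟩
    · exact ⟨4, h.1, h4 fun hi4 => hi (hi4 ▸ h.1)⟩

theorem leftSegment_or_rightSegment_of_adj (hA : CutConnected (GCirc n).Adj A)
    (h1 : Sum.inl 1 ∉ A) (hne : ∃ i, Sum.inl i ∈ A) {k : Fin (n - 12)} (hk : Sum.inr k ∉ A)
    {a : Fin 12 ⊕ Fin (n - 12)} (ha : a ∈ A) (hadj : (GCirc n).Adj a (Sum.inr k)) :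
    LeftSegment A k ∨ RightSegment A k := by
  obtain i | l := a
  · rcases gCirc_adj_inl_inr.1 hadj with ⟨rfl, hl⟩ | ⟨rfl, hl⟩ | rfl
    · exact Or.inl ⟨ha, fun j hj => by omega⟩
    · exact Or.inr ⟨ha, fun j hj => by omega⟩
    · exact absurd ha h1
  · rw [gCirc_adj_inr_inr] at hadj
    rcases leftSegment_or_rightSegment_of_mem hA h1 hne ha with h | h
    · refine Or.inl ⟨h.1, fun j hj => ?_⟩
      rcases hadj with hadj | hadj
      · by_cases hjl : j = l
        · exact hjl ▸ ha
        · exact h.2 j (by omega)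
      · exact absurd (h.2 k (by omega)) hk
    · refine Or.inr ⟨h.1, fun j hj => ?_⟩
      rcases hadj with hadj | hadj
      · exact absurd (h.2 k (by omega)) hk
      · by_cases hjl : j = l
        · exact hjl ▸ ha
        · exact h.2 j (by omega)

theorem LeftSegment.eq {k l : Fin (n - 12)} (hk : LeftSegment A k) (hl : LeftSegment A l)
    (hkA : Sum.inr k ∉ A) (hlA : Sum.inr l ∉ A) : k = l :=
  le_antisymm (not_lt.1 fun h => hlA (hk.2 l h)) (not_lt.1 fun h => hkA (hl.2 k h))

theorem RightSegment.eq {k l : Fin (n - 12)} (hk : RightSegment A k) (hl : RightSegment A l)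
    (hkA : Sum.inr k ∉ A) (hlA : Sum.inr l ∉ A) : k = l :=
  le_antisymm (not_lt.1 fun h => hkA (hl.2 k h)) (not_lt.1 fun h => hlA (hk.2 l h))

open Classical in
/-- If `h²` is not in `A`, then at most one path vertex outside `A` follows an initial segment
contained in `A` and at most one precedes such a final segment. -/
theorem card_le_of_segment {C : Finset (Fin (n - 12))} (hC : ∀ k ∈ C, Sum.inr k ∉ A)
    (hseg : ∀ k ∈ C, LeftSegment A k ∨ RightSegment A k) :
    C.card ≤ (decide (Sum.inl 2 ∈ A)).toNat + (decide (Sum.inl 4 ∈ A)).toNat := by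
  have hL : (C.filter (LeftSegment A)).card ≤ (decide (Sum.inl 2 ∈ A)).toNat := by
    by_cases h : Sum.inl 2 ∈ A
    · simp only [h, decide_true, Bool.toNat_true, Finset.card_le_one, Finset.mem_filter]
      exact fun k hk l hl => hk.2.eq hl.2 (hC k hk.1) (hC l hl.1)
    · rw [Finset.filter_false_of_mem fun k _ hk => h hk.1]
      simp
  have hR : (C.filter (RightSegment A)).card ≤ (decide (Sum.inl 4 ∈ A)).toNat := by
    by_cases h : Sum.inl 4 ∈ A
    · simp only [h, decide_true, Bool.toNat_true, Finset.card_le_one, Finset.mem_filter]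
      exact fun k hk l hl => hk.2.eq hl.2 (hC k hk.1) (hC l hl.1)
    · rw [Finset.filter_false_of_mem fun k _ hk => h hk.1]
      simp
  calc C.card ≤ (C.filter (LeftSegment A) ∪ C.filter (RightSegment A)).card :=
        Finset.card_le_card fun k hk => by
          rcases hseg k hk with h | h <;> simp [hk, h]
    _ ≤ _ := (Finset.card_union_le _ _).trans (add_le_add hL hR)

open Classical in
theorem card_le_pathBonus (hA : CutConnected (GCirc n).Adj A) (hB : CutConnected (GCirc n).Adj B)
    (hneA : ∃ i, Sum.inl i ∈ A) (hneB : ∃ i, Sum.inl i ∈ B) (hAB : Disjoint A B)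
    {C : Finset (Fin (n - 12))}
    (hC : ∀ k ∈ C, Sum.inr k ∉ A ∧ Sum.inr k ∉ B ∧
      (∃ a ∈ A, (GCirc n).Adj a (Sum.inr k)) ∧ ∃ b ∈ B, (GCirc n).Adj b (Sum.inr k)) :
    C.card ≤ pathBonus (mask (Finset.univ.filter fun i => Sum.inl i ∈ A))
      (mask (Finset.univ.filter fun i => Sum.inl i ∈ B)) := by
  have hmask (S : Set (Fin 12 ⊕ Fin (n - 12))) (i : Fin 12) :
      (mask (Finset.univ.filter fun i => Sum.inl i ∈ S)).testBit i = decide (Sum.inl i ∈ S) := by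
    simp
  have hsegA (h1 : Sum.inl 1 ∉ A) (k) (hk : k ∈ C) : LeftSegment A k ∨ RightSegment A k := by
    obtain ⟨hkA, -, ⟨a, ha, hadj⟩, -⟩ := hC k hk
    exact leftSegment_or_rightSegment_of_adj hA h1 hneA hkA ha hadj
  have hsegB (h1 : Sum.inl 1 ∉ B) (k) (hk : k ∈ C) : LeftSegment B k ∨ RightSegment B k := by
    obtain ⟨-, hkB, -, ⟨b, hb, hadj⟩⟩ := hC k hk
    exact leftSegment_or_rightSegment_of_adj hB h1 hneB hkB hb hadj
  have hdisj {x} : x ∈ A → x ∉ B := fun h => Set.disjoint_left.1 hAB h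
  have hA1 := hmask A 1
  have hA2 := hmask A 2
  have hA4 := hmask A 4
  have hB1 := hmask B 1
  have hB2 := hmask B 2
  have hB4 := hmask B 4
  simp only [Fin.coe_ofNat_eq_mod, Nat.reduceMod] at hA1 hA2 hA4 hB1 hB2 hB4
  simp only [pathBonus, hA1, hA2, hA4, hB1, hB2, hB4, decide_eq_true_iff]
  split_ifs with h1 h1'
  · exact card_le_of_segment (fun k hk => (hC k hk).2.1) (hsegB (hdisj h1))
  · exact card_le_of_segment (fun k hk => (hC k hk).1) (hsegA h1)
  · have hboth (k) (hk : k ∈ C) :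
        (LeftSegment A k ∧ RightSegment B k) ∨ (RightSegment A k ∧ LeftSegment B k) := by
      rcases hsegA h1 k hk with h | h <;> rcases hsegB h1' k hk with h' | h'
      · exact absurd h'.1 (hdisj h.1)
      · exact Or.inl ⟨h, h'⟩
      · exact Or.inr ⟨h, h'⟩
      · exact absurd h'.1 (hdisj h.1)
    obtain rfl | ⟨k₀, hk₀⟩ := C.eq_empty_or_nonempty
    · simp
    · have hle : C.card ≤ 1 := by
        refine Finset.card_le_one.2 fun k hk l hl => ?_
        rcases hboth k hk with h | h <;> rcases hboth l hl with h' | h'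
        · exact h.1.eq h'.1 (hC k hk).1 (hC l hl).1
        · exact absurd h'.2.1 (hdisj h.1.1)
        · exact absurd h.2.1 (hdisj h'.1.1)
        · exact h.1.eq h'.1 (hC k hk).1 (hC l hl).1
      rcases hboth k₀ hk₀ with h | h
      · simpa [h.1.1, h.2.1] using hle
      · simpa [h.1.1, h.2.1] using hle

/-- A connected set of path vertices has at most five neighbours. -/
theorem exists_inl_mem (hA : CutConnected (GCirc n).Adj A)
    {C : Finset (Fin 12 ⊕ Fin (n - 12))} (hcard : 5 < C.card)
    (hC : ∀ c ∈ C, c ∉ A ∧ ∃ a ∈ A, (GCirc n).Adj a c) : ∃ i, Sum.inl i ∈ A := by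
  classical
  by_contra! hbase
  have hclosed (k : Fin (n - 12)) (hk : Sum.inr k ∉ A) (j l : Fin (n - 12))
      (hj : Sum.inr j ∈ A) (hl : Sum.inr l ∈ A) (hjk : j < k) : l < k := by
    have := hA.2 {x ∈ A | ∃ i < k, x = Sum.inr i} (fun x hx => hx.1) ⟨_, hj, j, hjk, rfl⟩ ?_
    · rw [← this] at hl
      obtain ⟨-, i, hi, hli⟩ := hl
      exact Sum.inr_injective hli ▸ hi
    · rintro _ ⟨hu, i, hi, rfl⟩ (v | v) hv hadj
      · exact absurd hv (hbase v)
      · refine ⟨hv, v, ?_, rfl⟩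
        rw [gCirc_adj_inr_inr] at hadj
        have : v ≠ k := fun h => hk (h ▸ hv)
        omega
  have hleft : C.toLeft ⊆ {1, 2, 4} := by
    intro i hi
    obtain ⟨-, a | k, ha, hadj⟩ := hC _ (Finset.mem_toLeft.1 hi)
    · exact absurd ha (hbase a)
    · rcases gCirc_adj_inl_inr.1 hadj.symm with ⟨rfl, -⟩ | ⟨rfl, -⟩ | rfl <;> simp
  have hright : C.toRight.card ≤ 2 := by
    let L := C.toRight.filter fun k : Fin (n - 12) =>
      ∃ l : Fin (n - 12), Sum.inr l ∈ A ∧ (l : ℕ) = k + 1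
    let R := C.toRight.filter fun k : Fin (n - 12) =>
      ∃ l : Fin (n - 12), Sum.inr l ∈ A ∧ (k : ℕ) = l + 1
    have hL : L.card ≤ 1 := by
      refine Finset.card_le_one.2 fun k hk l hl => ?_
      obtain ⟨hkC, k', hk', hkk⟩ := Finset.mem_filter.1 hk
      obtain ⟨hlC, l', hl', hll⟩ := Finset.mem_filter.1 hl
      have hkA := (hC _ (Finset.mem_toRight.1 hkC)).1
      have hlA := (hC _ (Finset.mem_toRight.1 hlC)).1
      have h1 := hclosed k hkA l' k' hl' hk'
      have h2 := hclosed l hlA k' l' hk' hl'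
      have h3 : k' ≠ l := fun h => hlA (h ▸ hk')
      have h4 : l' ≠ k := fun h => hkA (h ▸ hl')
      omega
    have hR : R.card ≤ 1 := by
      refine Finset.card_le_one.2 fun k hk l hl => ?_
      obtain ⟨hkC, k', hk', hkk⟩ := Finset.mem_filter.1 hk
      obtain ⟨hlC, l', hl', hll⟩ := Finset.mem_filter.1 hl
      have hkA := (hC _ (Finset.mem_toRight.1 hkC)).1
      have hlA := (hC _ (Finset.mem_toRight.1 hlC)).1
      have h1 := hclosed k hkA k' l' hk' hl'
      have h2 := hclosed l hlA l' k' hl' hk'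
      have h3 : k' ≠ l := fun h => hlA (h ▸ hk')
      have h4 : l' ≠ k := fun h => hkA (h ▸ hl')
      omega
    calc C.toRight.card ≤ (L ∪ R).card := Finset.card_le_card fun k hk => by
          obtain ⟨-, a | l, ha, hadj⟩ := hC _ (Finset.mem_toRight.1 hk)
          · exact absurd ha (hbase a)
          · rw [Finset.mem_union]
            rw [gCirc_adj_inr_inr] at hadj
            exact hadj.symm.imp (fun h => Finset.mem_filter.2 ⟨hk, l, ha, h⟩)
              (fun h => Finset.mem_filter.2 ⟨hk, l, ha, h⟩)
      _ ≤ _ := (Finset.card_union_le _ _).trans (add_le_add hL hR)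
  have h1 := Finset.card_le_card hleft
  have h2 : ({1, 2, 4} : Finset (Fin 12)).card = 3 := rfl
  have h3 := C.card_toLeft_add_card_toRight
  omega

/-- Two disjoint connected sets of vertices of `GCirc n` have at most five common neighbours. -/
theorem gCirc_card_commonNbrs_le (hA : CutConnected (GCirc n).Adj A)
    (hB : CutConnected (GCirc n).Adj B) (hAB : Disjoint A B)
    {C : Finset (Fin 12 ⊕ Fin (n - 12))}
    (hC : ∀ c ∈ C, c ∉ A ∧ c ∉ B ∧ (∃ a ∈ A, (GCirc n).Adj a c) ∧ ∃ b ∈ B, (GCirc n).Adj b c) :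
    C.card ≤ 5 := by
  classical
  by_contra! hcard
  have hneA := exists_inl_mem hA hcard fun c hc => ⟨(hC c hc).1, (hC c hc).2.2.1⟩
  have hneB := exists_inl_mem hB hcard fun c hc => ⟨(hC c hc).2.1, (hC c hc).2.2.2⟩
  have h1 := card_le_pathBonus hA hB hneA hneB hAB (C := C.toRight)
    fun k hk => hC _ (Finset.mem_toRight.1 hk)
  have h2 := card_add_pathBonus_lt (A := Finset.univ.filter fun i => Sum.inl i ∈ A)
    (B := Finset.univ.filter fun i => Sum.inl i ∈ B) (C := C.toLeft)
    (by simpa using hA.trace hneA) (by simpa using hB.trace hneB)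
    (Finset.disjoint_left.2 fun i hi hi' => Set.disjoint_left.1 hAB
      (Finset.mem_filter.1 hi).2 (Finset.mem_filter.1 hi').2) ?_
  · have h3 := C.card_toLeft_add_card_toRight
    omega
  · intro i hi
    obtain ⟨hiA, hiB, ⟨a, ha, hadja⟩, ⟨b, hb, hadjb⟩⟩ := hC _ (Finset.mem_toLeft.1 hi)
    simp only [Finset.mem_filter, Finset.mem_univ, true_and]
    exact ⟨hiA, hiB, exists_baseAdj_of_adj hA hneA hiA ha hadja,
      exists_baseAdj_of_adj hB hneB hiB hb hadjb⟩

end Trace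

section Minor

variable {V : Type*} {G : SimpleGraph V}

theorem CutConnected.of_induce {S : Set V} (h : (G.induce S).Connected) :
    CutConnected G.Adj S := by
  obtain ⟨⟨x, hx⟩⟩ := h.nonempty
  refine ⟨⟨x, hx⟩, fun T hT ⟨y, hy⟩ hcl => subset_antisymm hT fun z hz => ?_⟩
  obtain ⟨w⟩ := h.preconnected ⟨y, hT hy⟩ ⟨z, hz⟩
  have key : ∀ u v : S, (G.induce S).Walk u v → (u : V) ∈ T → (v : V) ∈ T := by
    intro u v w
    induction w with
    | nil => exact id
    | cons hadj _ ih => exact fun hu => ih (hcl _ hu _ (Subtype.property _) hadj)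
  exact key _ _ w hy

/-- The vertices reachable from `A` by walks all of whose other vertices are in `D`. -/
inductive ReachableThrough (G : SimpleGraph V) (A D : Set V) : V → Prop
  | base {v : V} : v ∈ A → ReachableThrough G A D v
  | step {u v : V} : ReachableThrough G A D u → v ∈ D → G.Adj u v → ReachableThrough G A D v

theorem CutConnected.reachableThrough {A : Set V} (hA : CutConnected G.Adj A) (D : Set V) :
    CutConnected G.Adj {v | ReachableThrough G A D v} := by
  refine ⟨hA.1.mono fun v hv => .base hv, fun T hT hne hcl => ?_⟩
  by_cases hTA : (T ∩ A).Nonempty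
  · have hAT : T ∩ A = A := hA.2 _ Set.inter_subset_right hTA
      fun u hu v hv huv => ⟨hcl u hu.1 v (.base hv) huv, hv⟩
    refine subset_antisymm hT fun v hv => ?_
    induction hv with
    | base hv => exact (hAT.symm.subset hv).1
    | step hu hv huv ih => exact hcl _ ih _ (ReachableThrough.step hu hv huv) huv
  · obtain ⟨x, hx⟩ := hne
    have key : ∀ v, ReachableThrough G A D v → v ∉ T := by
      intro v hv
      induction hv with
      | base hv => exact fun h => hTA ⟨_, h, hv⟩
      | step hu hv huv ih => exact fun h => ih (hcl _ h _ hu huv.symm)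
    exact absurd hx (key x (hT hx))

/-- In a `K_{2,m}` minor, the branch sets on the side of size `m` may be taken to be singletons. -/
theorem exists_commonNbrs_of_minor {ι : Type*} {A B : Set V} {C : ι → Set V}
    (hA : CutConnected G.Adj A) (hC : ∀ i, CutConnected G.Adj (C i)) (hAB : Disjoint A B)
    (hAC : ∀ i, Disjoint A (C i)) (hBC : ∀ i, Disjoint B (C i))
    (hCC : ∀ i j, i ≠ j → Disjoint (C i) (C j))
    (hadjA : ∀ i, ∃ a ∈ A, ∃ c ∈ C i, G.Adj a c) (hadjB : ∀ i, ∃ b ∈ B, ∃ c ∈ C i, G.Adj b c) :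
    ∃ A' : Set V, CutConnected G.Adj A' ∧ Disjoint A' B ∧ ∃ c : ι → V, Function.Injective c ∧
      ∀ i, c i ∉ A' ∧ c i ∉ B ∧ (∃ a ∈ A', G.Adj a (c i)) ∧ ∃ b ∈ B, G.Adj b (c i) := by
  let N : Set V := {v | ∃ b ∈ B, G.Adj b v}
  let D : Set V := {v | (∃ i, v ∈ C i) ∧ v ∉ N}
  have hmem {v} (hv : ReachableThrough G A D v) : v ∈ A ∨ v ∈ D := by
    cases hv with
    | base h => exact Or.inl h
    | step _ h _ => exact Or.inr h
  have hex (i : ι) : ∃ c ∈ C i, c ∈ N ∧ ∃ a, ReachableThrough G A D a ∧ G.Adj a c := by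
    by_contra! hno
    have hD {a c} (ha : ReachableThrough G A D a) (hc : c ∈ C i) (hac : G.Adj a c) :
        ReachableThrough G A D c :=
      .step ha ⟨⟨i, hc⟩, fun hN => hno c hc hN a ha hac⟩ hac
    obtain ⟨a, ha, x, hx, hax⟩ := hadjA i
    obtain ⟨b, hb, y, hy, hby⟩ := hadjB i
    have := (hC i).2 {v ∈ C i | ReachableThrough G A D v} (fun v hv => hv.1)
      ⟨x, hx, hD (.base ha) hx hax⟩ fun u hu v hv huv => ⟨hv, hD hu.2 hv huv⟩
    rw [← this] at hy
    rcases hmem hy.2 with h | h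
    · exact Set.disjoint_left.1 (hAC i) h hy.1
    · exact h.2 ⟨b, hb, hby⟩
  choose c hcC hcN a ha hac using hex
  refine ⟨_, hA.reachableThrough D, ?_, c, fun i j hij => ?_, fun i => ⟨fun h => ?_, ?_, ?_, hcN i⟩⟩
  · refine Set.disjoint_left.2 fun v hv hvB => ?_
    rcases hmem hv with h | ⟨⟨i, hi⟩, -⟩
    · exact Set.disjoint_left.1 hAB h hvB
    · exact Set.disjoint_left.1 (hBC i) hvB hi
  · by_contra hne
    exact Set.disjoint_left.1 (hCC i j hne) (hcC i) (hij ▸ hcC j)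
  · rcases hmem h with h | h
    · exact Set.disjoint_left.1 (hAC i) h (hcC i)
    · exact h.2 (hcN i)
  · exact Set.disjoint_right.1 (hBC i) (hcC i)
  · exact ⟨a i, ha i, hac i⟩

end Minor

theorem gCirc_no_K26_minor (n : ℕ) (hn : 13 ≤ n) :
    ¬ HasMinor (GCirc n) (completeBipartiteGraph (Fin 2) (Fin 6)) := by
  rintro ⟨S, -, hdisj, hconn, hadj⟩
  have hadj' (i : Fin 2) (j : Fin 6) := hadj (Sum.inl i) (Sum.inr j) (by simp)
  obtain ⟨A, hA, hAB, c, hc, hcommon⟩ := exists_commonNbrs_of_minor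
    (A := S (Sum.inl 0)) (B := S (Sum.inl 1)) (C := fun j : Fin 6 => S (Sum.inr j))
    (.of_induce (hconn _)) (fun _ => .of_induce (hconn _)) (hdisj _ _ (by simp))
    (fun _ => hdisj _ _ (by simp)) (fun _ => hdisj _ _ (by simp))
    (fun i j hij => hdisj _ _ (by simpa using hij)) (hadj' 0) (hadj' 1)
  have := gCirc_card_commonNbrs_le hA (.of_induce (hconn (Sum.inl 1))) hAB
    (C := Finset.univ.map ⟨c, hc⟩) (by simpa using hcommon)
  simp at this
end
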